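/- arXiv:0903.5143 — 5 statements merged into one kernel-verified Lean document; each statement's English description precedes it below -/
import Mathlib

section
/- Let d and n be positive integers and let O(d) carry its Haar probability measure. Let W be a symmetric real matrix indexed by M(2n) satisfying G·W·G = G, where G = G_n^{O(d)} is the Gram matrix. Then for any index functions i, j : Fin (2n) → Fin d, the integral ∫_{O(d)} ∏_{k=1}^{2n} g_{i(k) j(k)} dg equals ∑_{𝔪,𝔫 ∈ M(2n)} W(𝔪,𝔫) · [i∘𝔪 = i] · [j∘𝔫 = j], where [P] is 1 if P holds and 0 otherwise (note that ∏_k δ_{i(𝔪(2k−1)), i(𝔪(2k))} = 1 precisely when i∘𝔪 = i). -/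
open MeasureTheory

/-- A pair partition of `{1,…,N}` identified with a fixed-point-free involution of `Fin N`. -/
def IsPairMatching {N : ℕ} (m : Equiv.Perm (Fin N)) : Prop :=
  (∀ x, m (m x) = x) ∧ (∀ x, m x ≠ x)

instance {N : ℕ} : DecidablePred (IsPairMatching (N := N)) := fun _ => by
  unfold IsPairMatching; infer_instance

/-- `Matchings N` is the set `M(N)` of pair partitions (fixed-point-free involutions). -/
def Matchings (N : ℕ) : Type := {m : Equiv.Perm (Fin N) // IsPairMatching m}

instance (N : ℕ) : Fintype (Matchings N) := Subtype.fintype _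
instance (N : ℕ) : DecidableEq (Matchings N) := Subtype.instDecidableEq

/-- number of orbits (cycles together with fixed points) of a permutation of `Fin N`. -/
def cycleCount {N : ℕ} (σ : Equiv.Perm (Fin N)) : ℕ :=
  σ.cycleType.card + (Finset.univ.filter fun x => σ x = x).card

/-- `loop(𝔪,𝔫)`: half the number of orbits of `𝔪 ∘ 𝔫`. -/
def loopCount {N : ℕ} (m p : Matchings N) : ℕ := cycleCount (m.1 * p.1) / 2

/-- The orthogonal Gram matrix `G_n^{O(d)}`. -/
noncomputable def GramO (d n : ℕ) : Matrix (Matchings (2*n)) (Matchings (2*n)) ℝ :=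
  fun m p => (d : ℝ) ^ loopCount m p

/-- The orthogonal group `O(d)`. -/
abbrev OrthGroup (d : ℕ) : Type := Matrix.orthogonalGroup (Fin d) ℝ

noncomputable instance (d : ℕ) : MeasurableSpace (OrthGroup d) := borel _

open ProbabilityTheory in
theorem integrable_pow_gaussianReal (n : ℕ) :
    Integrable (fun x : ℝ => x ^ n) (gaussianReal 0 1) := by
  have h := (memLp_id_gaussianReal (μ := 0) (v := 1) n).integrable_norm_pow'
  refine (integrable_norm_iff (by fun_prop)).mp ?_
  simpa using h

open ProbabilityTheory in
theorem integrable_pow_mul_gaussianPDFReal (n : ℕ) :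
    Integrable (fun x : ℝ => x ^ n * gaussianPDFReal 0 1 x) := by
  have h := integrable_pow_gaussianReal n
  rw [gaussianReal_of_var_ne_zero 0 one_ne_zero,
    integrable_withDensity_iff (measurable_gaussianPDF _ _)
      (.of_forall fun _ => gaussianPDF_lt_top)] at h
  simpa using h

open ProbabilityTheory in
theorem hasDerivAt_gaussianPDFReal (x : ℝ) :
    HasDerivAt (gaussianPDFReal 0 1) (-(x * gaussianPDFReal 0 1 x)) x := by
  have h : HasDerivAt (fun x : ℝ => -(x - 0) ^ 2 / (2 * 1)) (-x) x := by
    have := ((hasDerivAt_id x).pow 2).neg.div_const 2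
    refine (this.congr_deriv (by simp; ring)).congr_of_eventuallyEq (.of_forall fun y => by simp)
  refine ((h.exp.const_mul (√(2 * Real.pi * (1 : NNReal)))⁻¹)).congr_deriv ?_
  simp [gaussianPDFReal]
  ring

open ProbabilityTheory in
theorem integral_pow_add_two_gaussianReal (n : ℕ) :
    ∫ x, x ^ (n + 2) ∂gaussianReal 0 1 = (n + 1) * ∫ x, x ^ n ∂gaussianReal 0 1 := by
  simp only [integral_gaussianReal_eq_integral_smul one_ne_zero, smul_eq_mul]
  have h := integral_mul_deriv_eq_deriv_mul_of_integrable
    (u := fun x : ℝ => x ^ (n + 1)) (u' := fun x => ((n + 1 : ℕ) : ℝ) * x ^ n)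
    (v := gaussianPDFReal 0 1) (v' := fun x => -(x * gaussianPDFReal 0 1 x))
    (fun x _ => by simpa using hasDerivAt_pow (n + 1) x)
    (fun x _ => hasDerivAt_gaussianPDFReal x)
    ((integrable_pow_mul_gaussianPDFReal (n + 2)).neg.congr
      (.of_forall fun x => by simp; ring))
    (((integrable_pow_mul_gaussianPDFReal n).const_mul ((n + 1 : ℕ) : ℝ)).congr
      (.of_forall fun x => by simp; ring))
    (integrable_pow_mul_gaussianPDFReal (n + 1))
  rw [← neg_inj, ← integral_neg, ← integral_const_mul]
  refine (integral_congr_ae (.of_forall fun x => ?_)).trans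
    (h.trans (congrArg _ (integral_congr_ae (.of_forall fun x => ?_))))
  · ring
  · push_cast
    ring

open ProbabilityTheory in
theorem integral_pow_odd_gaussianReal (k : ℕ) :
    ∫ x, x ^ (2 * k + 1) ∂gaussianReal 0 1 = 0 := by
  induction k with
  | zero => simp
  | succ k ih =>
    rw [show 2 * (k + 1) + 1 = 2 * k + 1 + 2 by ring, integral_pow_add_two_gaussianReal, ih,
      mul_zero]

open ProbabilityTheory in
theorem integral_pow_even_gaussianReal (k : ℕ) :
    (∫ x, x ^ (2 * k) ∂gaussianReal 0 1) * (2 ^ k * k.factorial) = (2 * k).factorial := by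
  induction k with
  | zero => simp
  | succ k ih =>
    rw [show 2 * (k + 1) = 2 * k + 2 by ring, integral_pow_add_two_gaussianReal,
      Nat.factorial_succ, Nat.factorial_succ, Nat.factorial_succ]
    push_cast
    rw [← ih]
    ring

/-- Pair partitions of a type, as fixed-point-free involutions. -/
def IsPairing {α : Type*} (σ : Equiv.Perm α) : Prop :=
  (∀ x, σ (σ x) = x) ∧ ∀ x, σ x ≠ x

theorem isPairing_iff_cycleType {α : Type*} [Fintype α] [DecidableEq α] {k : ℕ}
    (hk : Fintype.card α = 2 * k) (σ : Equiv.Perm α) :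
    IsPairing σ ↔ σ.cycleType = Multiset.replicate k 2 := by
  have hsupp : σ.support = Finset.univ ↔ ∀ x, σ x ≠ x := by
    simp [Finset.ext_iff]
  constructor
  · rintro ⟨h1, h2⟩
    have h := Equiv.Perm.cycleType_of_pow_prime_eq_one (σ := σ) (p := 2)
      (by ext x; simp [pow_two, h1])
    have hs := σ.sum_cycleType
    rw [hsupp.2 h2, Finset.card_univ, hk, h, Multiset.sum_replicate, smul_eq_mul] at hs
    rw [h]
    congr 1
    lia
  · intro h
    constructor
    · have : σ ^ 2 = 1 := Equiv.Perm.pow_prime_eq_one_iff.2 fun c hc => by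
        rw [h] at hc; exact Multiset.eq_of_mem_replicate hc
      intro x
      simpa [pow_two] using Equiv.congr_fun this x
    · rw [← hsupp, ← Finset.card_eq_iff_eq_univ, hk, ← σ.sum_cycleType, h]
      simp [mul_comm]

theorem even_card_of_isPairing {α : Type*} [Fintype α] {σ : Equiv.Perm α} (h : IsPairing σ) :
    Even (Fintype.card α) := by
  by_contra hodd
  classical
  obtain ⟨x, hx⟩ := Equiv.Perm.exists_fixed_point_of_prime (p := 2) (n := 1) (σ := σ)
    (by rwa [← even_iff_two_dvd]) (by ext x; simp [pow_two, h.1])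
  exact h.2 x hx

open ProbabilityTheory in
theorem integral_pow_card_gaussianReal (α : Type*) [Fintype α] :
    ∫ x, x ^ Fintype.card α ∂gaussianReal 0 1
      = Nat.card {σ : Equiv.Perm α // IsPairing σ} := by
  classical
  rcases Nat.even_or_odd' (Fintype.card α) with ⟨k, hk | hk⟩
  · have h := Equiv.Perm.card_of_cycleType_mul_eq α (Multiset.replicate k 2)
    have hcard : Nat.card {σ : Equiv.Perm α // IsPairing σ}
        = (Finset.univ.filter fun σ : Equiv.Perm α =>
            σ.cycleType = Multiset.replicate k 2).card := by
      simp only [isPairing_iff_cycleType hk]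
      rw [Nat.card_eq_fintype_card, Fintype.card_subtype]
    have hprod : (∏ n ∈ (Multiset.replicate k 2).toFinset,
        ((Multiset.replicate k 2).count n).factorial) = k.factorial := by
      rcases k.eq_zero_or_pos with rfl | hk0
      · simp
      · simp [Multiset.toFinset_replicate, hk0.ne']
    rw [← hcard, hprod, if_pos ⟨by simp [hk, mul_comm],
      fun a ha => (Multiset.eq_of_mem_replicate ha).ge⟩, hk] at h
    simp only [Multiset.sum_replicate, smul_eq_mul, mul_comm k 2, Nat.sub_self,
      Nat.factorial_zero, one_mul, Multiset.prod_replicate] at h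
    have hm := integral_pow_even_gaussianReal k
    rw [← h] at hm
    push_cast at hm
    rw [hk]
    exact mul_right_cancel₀ (by positivity) hm
  · have : IsEmpty {σ : Equiv.Perm α // IsPairing σ} :=
      ⟨fun σ => by have := even_card_of_isPairing σ.2; grind⟩
    rw [hk, integral_pow_odd_gaussianReal]
    simp

/-- A pairing preserving `c` amounts to a pairing of each fibre of `c`. -/
def pairingFiberEquiv {α C : Type*} (c : α → C) :
    {σ : Equiv.Perm α // IsPairing σ ∧ c ∘ σ = c} ≃
      ∀ b, {σ : Equiv.Perm {a // c a = b} // IsPairing σ} where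
  toFun σ b := ⟨σ.1.subtypePerm fun a => by rw [← Function.comp_apply (f := c), σ.2.2],
    fun x => Subtype.ext (σ.2.1.1 x), fun x h => σ.2.1.2 x (congrArg Subtype.val h)⟩
  invFun τ := ⟨DomMulAct.stabilizerEquiv_invFun_aux fun b => (τ b).1, by
    have hτ (x : α) : DomMulAct.stabilizerEquiv_invFun_aux (fun b => (τ b).1) x
        = ((τ (c x)).1 ⟨x, rfl⟩ : α) := rfl
    refine ⟨⟨fun x => ?_, fun x h => (τ (c x)).2.2 ⟨x, rfl⟩ (Subtype.ext h)⟩,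
      funext fun x => ((τ (c x)).1 ⟨x, rfl⟩).2⟩
    refine (DomMulAct.stabilizerEquiv_invFun_eq (fun b => (τ b).1)
      ((τ (c x)).1 ⟨x, rfl⟩).2).trans ?_
    exact congrArg Subtype.val ((τ (c x)).2.1 ⟨x, rfl⟩)⟩
  left_inv σ := rfl
  right_inv τ := by
    ext b a
    exact DomMulAct.stabilizerEquiv_invFun_eq (fun b => (τ b).1) a.2

open ProbabilityTheory in
/-- The standard Gaussian measure on `ℝ^C`. -/
noncomputable abbrev stdGaussianPi (C : Type*) [Fintype C] : Measure (C → ℝ) :=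
  Measure.pi fun _ => gaussianReal 0 1

theorem prod_comp_eq_prod_pow_card {α C : Type*} [Fintype α] [Fintype C] [DecidableEq C]
    (c : α → C) (x : C → ℝ) :
    ∏ k, x (c k) = ∏ b, x b ^ Fintype.card {a // c a = b} := by
  rw [← Finset.prod_fiberwise' Finset.univ c]
  simp [Fintype.card_subtype]

theorem integrable_prod_stdGaussianPi {α C : Type*} [Fintype α] [Fintype C] (c : α → C) :
    Integrable (fun x => ∏ k, x (c k)) (stdGaussianPi C) := by
  classical
  simp only [prod_comp_eq_prod_pow_card c]
  exact Integrable.fintype_prod fun b => integrable_pow_gaussianReal _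

/-- Wick's formula for independent standard Gaussian variables. -/
theorem integral_prod_stdGaussianPi {α C : Type*} [Fintype α] [Fintype C] (c : α → C) :
    ∫ x, ∏ k, x (c k) ∂stdGaussianPi C
      = Nat.card {σ : Equiv.Perm α // IsPairing σ ∧ c ∘ σ = c} := by
  classical
  simp only [prod_comp_eq_prod_pow_card c]
  rw [integral_fintype_prod_eq_prod (f := fun b (x : ℝ) => x ^ Fintype.card {a // c a = b}),
    Nat.card_congr (pairingFiberEquiv c), Nat.card_pi]
  push_cast
  exact Finset.prod_congr rfl fun b _ => integral_pow_card_gaussianReal _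

open ProbabilityTheory in
instance : (gaussianReal 0 1).IsOpenPosMeasure :=
  (gaussianReal_absolutelyContinuous' 0 one_ne_zero).isOpenPosMeasure

/-- The tensor power of a matrix. -/
def tensorPow (α : Type*) [Fintype α] {ι κ : Type*} (X : Matrix ι κ ℝ) :
    Matrix (α → ι) (α → κ) ℝ :=
  fun i j => ∏ k, X (i k) (j k)

section tensorPow

variable {α ι : Type*} [Fintype α]

theorem tensorPow_transpose (X : Matrix ι ι ℝ) :
    tensorPow α X.transpose = (tensorPow α X).transpose := rfl

theorem tensorPow_one [DecidableEq ι] : tensorPow α (1 : Matrix ι ι ℝ) = 1 := by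
  ext i j
  simp only [tensorPow, Matrix.one_apply, Finset.prod_ite_zero, Finset.prod_const_one,
    Finset.mem_univ, true_imp_iff, funext_iff]

variable [Fintype ι] [DecidableEq α]

theorem tensorPow_mul (X Y : Matrix ι ι ℝ) :
    tensorPow α (X * Y) = tensorPow α X * tensorPow α Y := by
  ext i j
  simp only [tensorPow, Matrix.mul_apply, ← Finset.prod_mul_distrib]
  rw [Finset.prod_univ_sum, Fintype.piFinset_univ]

open Matrix in
theorem dotProduct_tensorPow_nonneg_of_transpose_mul (B : Matrix ι ι ℝ) (T : (α → ι) → ℝ) :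
    0 ≤ T ⬝ᵥ (tensorPow α (Bᵀ * B) *ᵥ T) := by
  rw [tensorPow_mul, tensorPow_transpose, ← Matrix.mulVec_mulVec, Matrix.dotProduct_mulVec,
    Matrix.vecMul_transpose]
  exact Finset.sum_nonneg fun _ _ => mul_self_nonneg _

open Matrix MatrixOrder in
/-- The polar decomposition of an invertible matrix. -/
theorem exists_orthogonal_mul_transpose_mul [DecidableEq ι] (X : Matrix ι ι ℝ)
    (hX : IsUnit X.det) :
    ∃ U ∈ Matrix.orthogonalGroup ι ℝ, ∃ B : Matrix ι ι ℝ, X = U * (Bᵀ * B) := by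
  have hA : (Xᵀ * X).PosSemidef := Matrix.posSemidef_conjTranspose_mul_self X
  have hRR : CFC.sqrt (Xᵀ * X) * CFC.sqrt (Xᵀ * X) = Xᵀ * X :=
    CFC.sqrt_mul_sqrt_self _ hA.nonneg
  obtain ⟨B, hB⟩ := CStarAlgebra.nonneg_iff_eq_star_mul_self.mp (CFC.sqrt_nonneg (Xᵀ * X))
  replace hB : CFC.sqrt (Xᵀ * X) = Bᵀ * B := hB
  rw [hB] at hRR
  have hR : IsUnit (Bᵀ * B).det := by
    refine isUnit_of_mul_isUnit_left (y := (Bᵀ * B).det) ?_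
    rw [← Matrix.det_mul, hRR, Matrix.det_mul, Matrix.det_transpose]
    exact hX.mul hX
  have hRt : (Bᵀ * B)ᵀ = Bᵀ * B := by simp
  refine ⟨X * (Bᵀ * B)⁻¹, ?_, B, (Matrix.nonsing_inv_mul_cancel_right _ _ hR).symm⟩
  rw [Matrix.mem_orthogonalGroup_iff', Matrix.transpose_mul,
    Matrix.transpose_nonsing_inv, hRt, Matrix.mul_assoc, ← Matrix.mul_assoc Xᵀ, ← hRR,
    Matrix.mul_assoc (Bᵀ * B), Matrix.mul_nonsing_inv _ hR, Matrix.mul_one,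
    Matrix.nonsing_inv_mul _ hR]

variable [DecidableEq ι]

open Matrix in
theorem dotProduct_tensorPow_nonneg {T : (α → ι) → ℝ}
    (hT : ∀ U ∈ Matrix.orthogonalGroup ι ℝ, tensorPow α U *ᵥ T = T) (X : Matrix ι ι ℝ) :
    0 ≤ T ⬝ᵥ (tensorPow α X *ᵥ T) := by
  have hunit (Y : Matrix ι ι ℝ) (hY : IsUnit Y.det) : 0 ≤ T ⬝ᵥ (tensorPow α Y *ᵥ T) := by
    obtain ⟨U, hU, B, rfl⟩ := exists_orthogonal_mul_transpose_mul Y hY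
    rw [tensorPow_mul, ← Matrix.mulVec_mulVec, Matrix.dotProduct_mulVec,
      ← Matrix.mulVec_transpose, ← tensorPow_transpose, hT Uᵀ (Unitary.star_mem hU)]
    exact dotProduct_tensorPow_nonneg_of_transpose_mul B T
  let F : ℝ → ℝ := fun t => T ⬝ᵥ (tensorPow α (X + t • 1) *ᵥ T)
  have hF : Continuous F := by
    simp only [F, dotProduct, mulVec, tensorPow]
    fun_prop
  have hdense : Dense {t : ℝ | ((-X).charpoly.eval t) ≠ 0} := by
    refine Set.Countable.dense_compl (𝕜 := ℝ) (s := {t : ℝ | (-X).charpoly.eval t = 0}) ?_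
    exact (Polynomial.finite_setOfPred_isRoot (-X).charpoly_monic.ne_zero).countable
  have hmem : (0 : ℝ) ∈ F ⁻¹' Set.Ici 0 := by
    refine closure_minimal (fun t ht => ?_) (isClosed_Ici.preimage hF) (hdense 0)
    refine hunit _ (isUnit_iff_ne_zero.2 ?_)
    rw [Set.mem_ofPred_eq, Matrix.eval_charpoly] at ht
    convert ht using 2
    rw [Matrix.smul_one_eq_diagonal, Matrix.scalar_apply, sub_neg_eq_add, add_comm]
  simpa [F] using hmem

open Matrix in
/-- An `O(d)`-invariant tensor orthogonal to all pairings vanishes. -/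
theorem eq_zero_of_invariant_of_orthogonal {T : (α → ι) → ℝ}
    (hT : ∀ U ∈ Matrix.orthogonalGroup ι ℝ, tensorPow α U *ᵥ T = T)
    (h0 : ∀ σ : Equiv.Perm α, IsPairing σ → ∑ i, T i * (if i ∘ σ = i then 1 else 0) = 0) :
    T = 0 := by
  let φ : (ι × ι → ℝ) → ℝ := fun x => T ⬝ᵥ (tensorPow α (fun a b => x (a, b)) *ᵥ T)
  have hφ (x) : φ x = ∑ i, ∑ j, T i * T j * ∏ k : α, x (i k, j k) := by
    simp only [φ, dotProduct, mulVec, tensorPow, Finset.mul_sum]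
    exact Finset.sum_congr rfl fun i _ => Finset.sum_congr rfl fun j _ => by ring
  have hint (i j : α → ι) :
      Integrable (fun x => T i * T j * ∏ k : α, x (i k, j k)) (stdGaussianPi (ι × ι)) :=
    (integrable_prod_stdGaussianPi fun k => (i k, j k)).const_mul _
  have hφint : Integrable φ (stdGaussianPi (ι × ι)) := by
    simp only [funext hφ]
    exact integrable_finsetSum _ fun i _ => integrable_finsetSum _ fun j _ => hint i j
  have hφcont : Continuous φ := by
    simp only [funext hφ]
    fun_prop
  have hzero : ∫ x, φ x ∂stdGaussianPi (ι × ι) = 0 := by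
    simp only [hφ]
    rw [integral_finsetSum _ fun i _ => integrable_finsetSum _ fun j _ => hint i j]
    simp_rw [integral_finsetSum _ fun j _ => hint _ j, integral_const_mul]
    classical
    have hW (i j : α → ι) : ∫ x, ∏ k : α, x (i k, j k) ∂stdGaussianPi (ι × ι)
        = ∑ σ : Equiv.Perm α with IsPairing σ,
            (if i ∘ σ = i then 1 else 0) * (if j ∘ σ = j then 1 else 0) := by
      rw [integral_prod_stdGaussianPi fun k => (i k, j k), Nat.card_eq_fintype_card,
        Fintype.card_subtype, ← Finset.filter_filter, Finset.card_filter]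
      push_cast
      refine Finset.sum_congr rfl fun σ _ => ?_
      rw [ite_zero_mul_ite_zero, one_mul]
      simp [funext_iff, forall_and]
    simp_rw [hW, Finset.mul_sum]
    rw [Finset.sum_congr rfl fun i _ => Finset.sum_comm, Finset.sum_comm]
    refine Finset.sum_eq_zero fun σ hσ => ?_
    refine (Finset.sum_congr rfl fun i _ => Finset.sum_congr rfl fun j _ =>
      mul_mul_mul_comm _ _ _ _).trans ?_
    simp only [← Finset.mul_sum, h0 σ (Finset.mem_filter.1 hσ).2, mul_zero,
      Finset.sum_const_zero]
  by_contra hne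
  refine (integral_pos_of_integrable_nonneg_nonzero (x := fun p => (1 : Matrix ι ι ℝ) p.1 p.2)
    hφcont hφint (fun x => dotProduct_tensorPow_nonneg hT _) ?_).ne' hzero
  have : φ (fun p => (1 : Matrix ι ι ℝ) p.1 p.2) = T ⬝ᵥ (tensorPow α 1 *ᵥ T) := rfl
  rw [this, tensorPow_one, one_mulVec]
  simpa using hne

end tensorPow

section pairing

theorem IsPairing.exists_equiv {α : Type*} [Fintype α] {σ : Equiv.Perm α} (hσ : IsPairing σ) :
    ∃ (S : Finset α) (e : S ⊕ S ≃ α), (∀ s, e (Sum.inr s) = σ (e (Sum.inl s))) := by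
  classical
  let r := Fintype.equivFin α
  let S : Finset α := Finset.univ.filter fun x => r x < r (σ x)
  have hS (x : α) : x ∈ S ↔ r x < r (σ x) := by simp [S]
  refine ⟨S, Equiv.ofBijective (Sum.elim (fun s => s.1) fun s => σ s.1) ⟨?_, fun x => ?_⟩,
    fun s => rfl⟩
  · refine Function.Injective.sumElim Subtype.val_injective
      (σ.injective.comp Subtype.val_injective) fun s t h => ?_
    have hs := (hS _).1 s.2
    have ht := (hS _).1 t.2
    rw [h, hσ.1] at hs
    exact hs.not_gt ht
  · rcases lt_trichotomy (r x) (r (σ x)) with h | h | h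
    · exact ⟨Sum.inl ⟨x, (hS x).2 h⟩, rfl⟩
    · exact absurd (r.injective h).symm (hσ.2 x)
    · exact ⟨Sum.inr ⟨σ x, (hS _).2 (by rwa [hσ.1])⟩, hσ.1 x⟩

theorem IsPairing.comp_eq_iff {α S ι : Type*} {σ : Equiv.Perm α} (hσ : IsPairing σ)
    {e : S ⊕ S ≃ α} (he : ∀ s, e (Sum.inr s) = σ (e (Sum.inl s))) (f : α → ι) :
    f ∘ σ = f ↔ ∀ s, f (e (Sum.inr s)) = f (e (Sum.inl s)) := by
  refine ⟨fun h s => by rw [he]; exact congrFun h _, fun h => funext fun x => ?_⟩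
  obtain ⟨s | s, rfl⟩ := e.surjective x
  · rw [Function.comp_apply, ← he, h]
  · rw [h, Function.comp_apply, he, hσ.1]

theorem IsPairing.card_comp_eq {α ι : Type*} [Fintype α] [Fintype ι] {σ : Equiv.Perm α}
    (hσ : IsPairing σ) :
    Nat.card {f : α → ι // f ∘ σ = f} = Fintype.card ι ^ (Fintype.card α / 2) := by
  obtain ⟨S, e, he⟩ := hσ.exists_equiv
  have hcard : Fintype.card α = 2 * Fintype.card S := by
    rw [← Fintype.card_congr e, Fintype.card_sum, two_mul]
  let E : {f : α → ι // f ∘ σ = f} ≃ (S → ι) :=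
    { toFun f s := f.1 (e (Sum.inl s))
      invFun g := ⟨Sum.elim g g ∘ e.symm, (hσ.comp_eq_iff he _).2 fun s => by simp⟩
      left_inv f := by
        refine Subtype.ext (funext fun x => ?_)
        obtain ⟨s | s, rfl⟩ := e.surjective x
        · simp
        · simpa using ((hσ.comp_eq_iff he _).1 f.2 s).symm
      right_inv g := by simp }
  classical
  rw [Nat.card_congr E, Nat.card_eq_fintype_card, Fintype.card_fun, hcard,
    Nat.mul_div_cancel_left _ two_pos]

open Matrix in
theorem IsPairing.tensorPow_mulVec {α ι : Type*} [Fintype α] [DecidableEq α] [Fintype ι]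
    [DecidableEq ι] {σ : Equiv.Perm α} (hσ : IsPairing σ) {U : Matrix ι ι ℝ}
    (hU : U ∈ Matrix.orthogonalGroup ι ℝ) :
    tensorPow α U *ᵥ (fun j => if j ∘ σ = j then 1 else 0)
      = fun i => if i ∘ σ = i then 1 else 0 := by
  obtain ⟨S, e, he⟩ := hσ.exists_equiv
  ext i
  let E : (α → ι) ≃ (S → ι) × (S → ι) :=
    (Equiv.arrowCongr e.symm (Equiv.refl ι)).trans (Equiv.sumArrowEquivProdArrow S S ι)
  have hE (j : α → ι) : j ∘ σ = j ↔ (E j).1 = (E j).2 := by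
    rw [hσ.comp_eq_iff he, eq_comm, funext_iff]
    rfl
  have hterm (j : α → ι) : tensorPow α U i j
      = ∏ s, U (i (e (Sum.inl s))) ((E j).1 s) * U (i (e (Sum.inr s))) ((E j).2 s) := by
    rw [tensorPow, ← e.prod_comp, Fintype.prod_sum_type, ← Finset.prod_mul_distrib]
    rfl
  have hUU (a b : ι) : ∑ c, U a c * U b c = if a = b then 1 else 0 := by
    rw [← Matrix.one_apply, ← (Matrix.mem_orthogonalGroup_iff ι ℝ).1 hU]
    rfl
  simp only [mulVec, dotProduct, hE, hterm]
  rw [E.sum_comp fun p : (S → ι) × (S → ι) =>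
    (∏ s, U (i (e (Sum.inl s))) (p.1 s) * U (i (e (Sum.inr s))) (p.2 s)) *
      if p.1 = p.2 then 1 else 0, Fintype.sum_prod_type]
  simp only [mul_ite, mul_one, mul_zero, Finset.sum_ite_eq, Finset.mem_univ, if_true]
  have hprod := Finset.prod_univ_sum (fun _ : S => (Finset.univ : Finset ι))
    fun s c => U (i (e (Sum.inl s))) c * U (i (e (Sum.inr s))) c
  rw [Fintype.piFinset_univ] at hprod
  rw [← hprod]
  simp only [hUU, Finset.prod_ite_zero, Finset.prod_const_one, Finset.mem_univ, true_imp_iff]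
  exact if_congr (funext_iff (f := (E i).1) (g := (E i).2)).symm rfl rfl

end pairing

section orbits

theorem card_quotient_sameCycle {N : ℕ} (σ : Equiv.Perm (Fin N)) :
    Nat.card (Quotient (Equiv.Perm.SameCycle.setoid σ)) = cycleCount σ := by
  classical
  let F : Fin N → Equiv.Perm (Fin N) ⊕ Fin N := fun x =>
    if σ x = x then Sum.inr x else Sum.inl (σ.cycleOf x)
  have hF (x y : Fin N) : F x = F y ↔ σ.SameCycle x y := by
    by_cases hx : σ x = x
    · by_cases hy : σ y = y
      · simp only [F, hx, hy, if_true, Sum.inr.injEq]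
        exact ⟨fun h => h ▸ .refl _ _, fun h => (h.eq_of_left hx)⟩
      · simp only [F, hx, hy, if_true, if_false, reduceCtorEq, false_iff]
        exact fun h => hy (h.apply_eq_self_iff.1 hx)
    · by_cases hy : σ y = y
      · simp only [F, hx, hy, if_true, if_false, reduceCtorEq, false_iff]
        exact fun h => hx (h.apply_eq_self_iff.2 hy)
      · simp only [F, hx, hy, if_false, Sum.inl.injEq]
        exact (Equiv.Perm.sameCycle_iff_cycleOf_eq_of_mem_support
          (Equiv.Perm.mem_support.2 hx) (Equiv.Perm.mem_support.2 hy)).symm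
  have hker : Equiv.Perm.SameCycle.setoid σ = Setoid.ker F := by
    ext x y
    exact (hF x y).symm
  have himage : Finset.univ.image F
      = σ.cycleFactorsFinset.disjSum (Finset.univ.filter fun x => σ x = x) := by
    ext (c | x)
    · simp only [Finset.mem_image, Finset.mem_univ, true_and, Finset.inl_mem_disjSum]
      constructor
      · rintro ⟨x, hx⟩
        by_cases h : σ x = x
        · simp [F, h] at hx
        · simp only [F, h, if_false, Sum.inl.injEq] at hx
          rw [← hx, Equiv.Perm.cycleOf_mem_cycleFactorsFinset_iff, Equiv.Perm.mem_support]
          exact h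
      · intro hc
        obtain ⟨x, hx⟩ := (Equiv.Perm.mem_cycleFactorsFinset_iff.1 hc).1.nonempty_support
        have hσx := Equiv.Perm.mem_support.1 (Equiv.Perm.mem_cycleFactorsFinset_support_le hc hx)
        exact ⟨x, by simp only [F, hσx, if_false, Equiv.Perm.cycle_is_cycleOf hx hc]⟩
    · simp only [Finset.mem_image, Finset.mem_univ, true_and, Finset.inr_mem_disjSum,
        Finset.mem_filter]
      constructor
      · rintro ⟨y, hy⟩
        by_cases h : σ y = y
        · simp only [F, h, if_true, Sum.inr.injEq] at hy
          exact hy ▸ h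
        · simp [F, h] at hy
      · exact fun h => ⟨x, by simp [F, h]⟩
  rw [hker, Nat.card_congr (Setoid.quotientKerEquivRange F), ← Set.image_univ,
    ← Finset.coe_univ, ← Finset.coe_image, Nat.card_coe_set_eq, Set.ncard_coe_finset, himage,
    Finset.card_disjSum, cycleCount, Equiv.Perm.cycleType_def, Multiset.card_map]
  rfl

variable {α : Type*} {m p : Equiv.Perm α}

theorem IsPairing.conj_mul (hm : IsPairing m) (hp : IsPairing p) :
    m * (m * p) * m⁻¹ = (m * p)⁻¹ := by
  have hm' : m * m = 1 := Equiv.ext hm.1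
  have hp' : p * p = 1 := Equiv.ext hp.1
  rw [mul_inv_rev, inv_eq_of_mul_eq_one_left hp', ← mul_assoc, hm', one_mul]

theorem IsPairing.apply_zpow (hm : IsPairing m) (hp : IsPairing p) (k : ℤ) (x : α) :
    m (((m * p) ^ k) x) = ((m * p) ^ (-k)) (m x) := by
  have h : m * (m * p) ^ k * m⁻¹ = (m * p) ^ (-k) := by
    rw [← conj_zpow, hm.conj_mul hp, inv_zpow']
  rw [← h]
  simp

theorem IsPairing.sameCycle_apply (hm : IsPairing m) (hp : IsPairing p) {x y : α}
    (h : (m * p).SameCycle x y) : (m * p).SameCycle (m x) (m y) := by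
  obtain ⟨k, rfl⟩ := h
  exact ⟨-k, (hm.apply_zpow hp k x).symm⟩

theorem IsPairing.not_sameCycle_apply (hm : IsPairing m) (hp : IsPairing p) (x : α) :
    ¬ (m * p).SameCycle x (m x) := by
  rintro ⟨k, hk⟩
  rcases Int.even_or_odd' k with ⟨l, rfl | rfl⟩
  · refine hm.2 (((m * p) ^ l) x) ?_
    rw [hm.apply_zpow hp, ← hk, ← Equiv.Perm.mul_apply, ← zpow_add]
    congr 2
    ring
  · refine hp.2 (((m * p) ^ l) x) (m.injective ?_)
    rw [hm.apply_zpow hp l, ← hk]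
    change ((m * p) * (m * p) ^ l) x = ((m * p) ^ (-l) * (m * p) ^ (2 * l + 1)) x
    rw [← zpow_add, ← zpow_one_add]
    congr 2
    ring

theorem card_comp_eq_and_comp_eq {N : ℕ} {ι : Type*} [Fintype ι] (m p : Matchings N) :
    Nat.card {f : Fin N → ι // f ∘ m.1 = f ∧ f ∘ p.1 = f}
      = Fintype.card ι ^ loopCount m p := by
  classical
  have hm : IsPairing m.1 := m.2
  have hp : IsPairing p.1 := p.2
  let s := Equiv.Perm.SameCycle.setoid (m.1 * p.1)
  let mbar : Quotient s → Quotient s :=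
    Quotient.map m.1 fun x y h => hm.sameCycle_apply hp h
  have hinv : Function.Involutive mbar := by
    rintro ⟨x⟩
    exact congrArg (Quotient.mk s) (hm.1 x)
  let M : Equiv.Perm (Quotient s) := hinv.toPerm
  have hM : IsPairing M := by
    refine ⟨hinv, ?_⟩
    rintro ⟨x⟩ h
    exact hm.not_sameCycle_apply hp x (Quotient.exact h).symm
  have hcomp (f : Fin N → ι) : (f ∘ m.1 = f ∧ f ∘ p.1 = f) →
      ∀ x y, (m.1 * p.1).SameCycle x y → f x = f y := by
    rintro ⟨h1, h2⟩ x y ⟨k, rfl⟩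
    have h : f ∘ (m.1 * p.1) = f := by
      rw [Equiv.Perm.coe_mul, ← Function.comp_assoc, h1, h2]
    induction k using Int.induction_on with
    | zero => rfl
    | succ k ih =>
      rw [add_comm, zpow_one_add, Equiv.Perm.mul_apply]
      exact ih.trans (congrFun h _).symm
    | pred k ih =>
      rw [ih, ← congrFun h (((m.1 * p.1) ^ (-(k : ℤ) - 1)) x), Function.comp_apply,
        ← Equiv.Perm.mul_apply, ← zpow_one_add]
      congr 3
      ring
  let E : {f : Fin N → ι // f ∘ m.1 = f ∧ f ∘ p.1 = f} ≃ {g : Quotient s → ι // g ∘ M = g} :=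
    { toFun f := ⟨Quotient.lift f.1 (hcomp f.1 f.2), by
        ext ⟨x⟩
        exact congrFun f.2.1 x⟩
      invFun g := by
        have h1 : (g.1 ∘ Quotient.mk s) ∘ m.1 = g.1 ∘ Quotient.mk s :=
          funext fun x => congrFun g.2 (Quotient.mk s x)
        refine ⟨g.1 ∘ Quotient.mk s, h1, funext fun x => ?_⟩
        rw [Function.comp_apply, ← congrFun h1]
        exact congrArg g.1 (Quotient.sound (s := s) (Equiv.Perm.SameCycle.symm ⟨1, by simp⟩))
      left_inv f := rfl
      right_inv g := by
        refine Subtype.ext (funext ?_)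
        rintro ⟨x⟩
        rfl }
  rw [Nat.card_congr E, hM.card_comp_eq, ← Nat.card_eq_fintype_card (α := Quotient s),
    card_quotient_sameCycle]
  rfl

end orbits

section gram

/-- The tensor attached to a pair partition, as a column indexed by the partition. -/
def pairingTensor (N d : ℕ) : Matrix (Fin N → Fin d) (Matchings N) ℝ :=
  fun i m => if i ∘ m.1 = i then 1 else 0

open Matrix

theorem pairingTensor_transpose_mul_self (d n : ℕ) :
    (pairingTensor (2 * n) d)ᵀ * pairingTensor (2 * n) d = GramO d n := by
  ext m p
  have h := card_comp_eq_and_comp_eq (ι := Fin d) m p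
  rw [Nat.card_eq_fintype_card, Fintype.card_subtype, Fintype.card_fin] at h
  rw [GramO, ← Nat.cast_pow, ← h, Finset.card_filter, Matrix.mul_apply]
  push_cast
  refine Finset.sum_congr rfl fun i _ => ?_
  simp only [Matrix.transpose_apply, pairingTensor, ite_zero_mul_ite_zero, one_mul]

theorem tensorPow_mul_pairingTensor {N d : ℕ} {U : Matrix (Fin d) (Fin d) ℝ}
    (hU : U ∈ Matrix.orthogonalGroup (Fin d) ℝ) :
    tensorPow (Fin N) U * pairingTensor N d = pairingTensor N d := by
  ext i m
  exact congrFun (IsPairing.tensorPow_mulVec m.2 hU) i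

theorem pairingTensor_transpose_mul_tensorPow {N d : ℕ} {U : Matrix (Fin d) (Fin d) ℝ}
    (hU : U ∈ Matrix.orthogonalGroup (Fin d) ℝ) :
    (pairingTensor N d)ᵀ * tensorPow (Fin N) U = (pairingTensor N d)ᵀ := by
  rw [← Matrix.transpose_transpose (tensorPow (Fin N) U), ← Matrix.transpose_mul,
    ← tensorPow_transpose, tensorPow_mul_pairingTensor (U := Uᵀ) (Unitary.star_mem hU)]

end gram

section haar

instance (d : ℕ) : BorelSpace (OrthGroup d) := ⟨rfl⟩

variable {d : ℕ} (μ : Measure (OrthGroup d))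

/-- The matrix of averages of products of entries, one for each element of `α`. -/
noncomputable def haarAverage (α : Type*) [Fintype α] : Matrix (α → Fin d) (α → Fin d) ℝ :=
  fun i j => ∫ g : OrthGroup d, tensorPow α (g : Matrix (Fin d) (Fin d) ℝ) i j ∂μ

theorem haarAverage_apply {α : Type*} [Fintype α] (i j : α → Fin d) :
    haarAverage μ α i j = ∫ g : OrthGroup d, tensorPow α (g : Matrix (Fin d) (Fin d) ℝ) i j ∂μ :=
  rfl

variable [IsProbabilityMeasure μ]

theorem integrable_tensorPow {α : Type*} [Fintype α] (i j : α → Fin d) :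
    Integrable (fun g : OrthGroup d => tensorPow α (g : Matrix (Fin d) (Fin d) ℝ) i j) μ := by
  have hcont : Continuous fun g : OrthGroup d =>
      ∏ k, (g : Matrix (Fin d) (Fin d) ℝ) (i k) (j k) :=
    continuous_finsetProd _ fun k _ => continuous_subtype_val.matrix_elem _ _
  refine Integrable.of_bound hcont.aestronglyMeasurable 1 (.of_forall fun g => ?_)
  rw [tensorPow, norm_prod]
  exact Finset.prod_le_one (fun _ _ => norm_nonneg _)
    fun k _ => entry_norm_bound_of_unitary g.2 _ _

open Matrix

theorem tensorPow_mul_haarAverage {α : Type*} [Fintype α] [DecidableEq α] [μ.IsHaarMeasure]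
    {U : Matrix (Fin d) (Fin d) ℝ} (hU : U ∈ Matrix.orthogonalGroup (Fin d) ℝ) :
    tensorPow α U * haarAverage μ α = haarAverage μ α := by
  ext i j
  have h := integral_mul_left_eq_self (μ := μ)
    (fun g : OrthGroup d => tensorPow α (g : Matrix (Fin d) (Fin d) ℝ) i j) ⟨U, hU⟩
  rw [haarAverage_apply, ← h, Matrix.mul_apply]
  simp only [haarAverage_apply, ← integral_const_mul]
  rw [← integral_finsetSum _ fun l _ => (integrable_tensorPow μ l j).const_mul _]
  refine integral_congr_ae (.of_forall fun g => ?_)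
  simp only [Submonoid.coe_mul, tensorPow_mul, Matrix.mul_apply]

theorem pairingTensor_transpose_mul_haarAverage (N : ℕ) :
    (pairingTensor N d)ᵀ * haarAverage μ (Fin N) = (pairingTensor N d)ᵀ := by
  ext m j
  simp only [Matrix.mul_apply, haarAverage_apply, ← integral_const_mul]
  rw [← integral_finsetSum _ fun l _ => (integrable_tensorPow μ l j).const_mul _]
  have h (g : OrthGroup d) := congrFun (congrFun
    (pairingTensor_transpose_mul_tensorPow (N := N) g.2) m) j
  simp only [Matrix.mul_apply] at h
  simp only [h]
  simp

theorem haarAverage_eq [μ.IsHaarMeasure] (n : ℕ)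
    (W : Matrix (Matchings (2 * n)) (Matchings (2 * n)) ℝ) (hWsymm : W.IsSymm)
    (hW : GramO d n * W * GramO d n = GramO d n) :
    haarAverage μ (Fin (2 * n))
      = pairingTensor (2 * n) d * W * (pairingTensor (2 * n) d)ᵀ := by
  set A := pairingTensor (2 * n) d with hA
  set P := haarAverage μ (Fin (2 * n)) with hP
  have hG : Aᵀ * A = GramO d n := pairingTensor_transpose_mul_self d n
  have hGW : GramO d n * W * Aᵀ = Aᵀ := by
    have hz : (GramO d n * W * Aᵀ - Aᵀ) * A = 0 := by
      rw [Matrix.sub_mul, Matrix.mul_assoc _ Aᵀ, hG, hW, sub_self]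
    rw [← sub_eq_zero, ← Matrix.self_mul_conjTranspose_eq_zero,
      Matrix.conjTranspose_eq_transpose_of_trivial]
    have : (GramO d n * W * Aᵀ - Aᵀ)ᵀ = A * (W * GramO d n - 1) := by
      rw [← hG]
      simp [Matrix.transpose_mul, hWsymm.eq, Matrix.mul_sub, Matrix.mul_assoc]
    rw [this, ← Matrix.mul_assoc, hz, Matrix.zero_mul]
  have hinv (U) (hU : U ∈ Matrix.orthogonalGroup (Fin d) ℝ) :
      tensorPow (Fin (2 * n)) U * (P - A * W * Aᵀ) = P - A * W * Aᵀ := by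
    rw [Matrix.mul_sub, tensorPow_mul_haarAverage μ hU, ← Matrix.mul_assoc, ← Matrix.mul_assoc,
      tensorPow_mul_pairingTensor hU]
  have horth : Aᵀ * (P - A * W * Aᵀ) = 0 := by
    rw [Matrix.mul_sub, pairingTensor_transpose_mul_haarAverage, ← Matrix.mul_assoc,
      ← Matrix.mul_assoc, hG, hGW, sub_self]
  rw [← sub_eq_zero]
  ext i j
  refine congrFun (eq_zero_of_invariant_of_orthogonal (T := fun i => (P - A * W * Aᵀ) i j)
    (fun U hU => funext fun i => congrFun (congrFun (hinv U hU) i) j) fun σ hσ => ?_) i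
  let m : Matchings (2 * n) := ⟨σ, hσ⟩
  have h : (Aᵀ * (P - A * W * Aᵀ)) m j = 0 := by
    rw [horth]
    rfl
  refine (Finset.sum_congr rfl fun i _ => ?_).trans (Matrix.mul_apply.symm.trans h)
  exact mul_comm _ _

end haar

theorem stmt0 (d n : ℕ) (hd : 0 < d) (hn : 0 < n)
    (μ : Measure (OrthGroup d)) [μ.IsHaarMeasure] [IsProbabilityMeasure μ]
    (W : Matrix (Matchings (2*n)) (Matchings (2*n)) ℝ)
    (hWsymm : W.IsSymm)
    (hW : GramO d n * W * GramO d n = GramO d n)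
    (i j : Fin (2*n) → Fin d) :
    (∫ g, (∏ k, ((g : Matrix (Fin d) (Fin d) ℝ) (i k) (j k))) ∂μ) =
      ∑ m : Matchings (2*n), ∑ p : Matchings (2*n),
        W m p * (if i ∘ ⇑m.1 = i then (1:ℝ) else 0) *
          (if j ∘ ⇑p.1 = j then (1:ℝ) else 0) := by
  have h := congrFun (congrFun (haarAverage_eq μ n W hWsymm hW) i) j
  refine h.trans ?_
  simp only [Matrix.mul_apply, Matrix.transpose_apply, pairingTensor, Finset.sum_mul]
  rw [Finset.sum_comm]
  exact Finset.sum_congr rfl fun m _ => Finset.sum_congr rfl fun p _ => by ring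
end

section
/- Let d and n be positive integers. A vector x ∈ ℝ^{Fin (2n) → Fin d} is fixed by the diagonal action of the orthogonal group (i.e., for every g ∈ O(d) and every index function i, ∑_{j : Fin (2n) → Fin d} (∏_{k=1}^{2n} g_{i(k) j(k)}) x_j = x_i) if and only if x lies in the linear span of the vectors ρ(𝔪), 𝔪 ∈ M(2n). Moreover, in the odd case, the only vector x ∈ ℝ^{Fin (2n+1) → Fin d} fixed by the diagonal action of O(d) is x = 0. -/
/-- The vector `ρ(𝔪)` in `(ℝ^d)^{⊗N} = ℝ^{Fin N → Fin d}`. -/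
def rho (d N : ℕ) (m : Matchings N) : (Fin N → Fin d) → ℝ :=
  fun i => if i ∘ ⇑m.1 = i then 1 else 0

lemma exists_boolSum_equiv {ι : Type} [DecidableEq ι] {k l : ι} (hkl : k ≠ l) :
    ∃ e : Bool ⊕ {t : ι // t ≠ k ∧ t ≠ l} ≃ ι,
      ∀ s, e s = Sum.elim (fun b => cond b l k) Subtype.val s := by
  refine ⟨Equiv.ofBijective (Sum.elim (fun b => cond b l k) Subtype.val) ⟨?_, ?_⟩, fun _ => rfl⟩
  · refine Function.Injective.sumElim ?_ Subtype.val_injective ?_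
    · rintro (_ | _) (_ | _) h <;> simp_all
    · rintro (_ | _) ⟨t, ht⟩ <;> simp [ht.1.symm, ht.2.symm]
  · intro t
    by_cases hk : t = k
    · exact ⟨Sum.inl false, by simp [hk]⟩
    by_cases hl : t = l
    · exact ⟨Sum.inl true, by simp [hl]⟩
    exact ⟨Sum.inr ⟨t, hk, hl⟩, rfl⟩

lemma sum_card_fiber {d : ℕ} {ι : Type} [Fintype ι] (i : ι → Fin d) :
    ∑ a, ((Finset.univ.filter fun k => i k = a).card : ℝ) = Fintype.card ι := by
  exact_mod_cast (Finset.card_eq_sum_card_fiberwise (f := i) (s := Finset.univ)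
    (t := Finset.univ) (by simp)).symm

section Tensor

variable {d : ℕ} {ι κ : Type} [Fintype ι] [Fintype κ]

/-- Invariance of a tensor with slots indexed by `ι` under the diagonal action of `O(d)`. -/
def IsOrthInvariant [DecidableEq ι] (x : (ι → Fin d) → ℝ) : Prop :=
  ∀ g ∈ Matrix.orthogonalGroup (Fin d) ℝ, ∀ i : ι → Fin d,
    ∑ j : ι → Fin d, (∏ k, g (i k) (j k)) * x j = x i

/-- Orthogonality of a tensor to the tensors of all perfect matchings of its slots. -/
def IsOrthogonalToMatchings [DecidableEq ι] (x : (ι → Fin d) → ℝ) : Prop :=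
  ∀ m : Equiv.Perm ι, (∀ k, m (m k) = k) → (∀ k, m k ≠ k) →
    ∑ i : ι → Fin d, (if i ∘ m = i then 1 else 0) * x i = 0

/-- The action of the matrix unit with entry `(a, b)` by derivations on tensors. -/
def unitAction [DecidableEq ι] (a b : Fin d) (x : (ι → Fin d) → ℝ) (i : ι → Fin d) : ℝ :=
  ∑ k, if i k = a then x (Function.update i k b) else 0

variable [DecidableEq ι] [DecidableEq κ]

lemma IsOrthInvariant.comp_equiv {x : (ι → Fin d) → ℝ} (hx : IsOrthInvariant x) (e : κ ≃ ι) :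
    IsOrthInvariant fun j : κ → Fin d => x (j ∘ e.symm) := by
  intro g hg i
  change _ = x (i ∘ e.symm)
  rw [← hx g hg (i ∘ e.symm)]
  refine Fintype.sum_equiv (e.arrowCongr (Equiv.refl _)) _ _ fun j => ?_
  congr 1
  exact Fintype.prod_equiv e _ _ fun k => by simp [Equiv.arrowCongr]

lemma IsOrthogonalToMatchings.comp_equiv {x : (ι → Fin d) → ℝ}
    (hx : IsOrthogonalToMatchings x) (e : κ ≃ ι) :
    IsOrthogonalToMatchings fun j : κ → Fin d => x (j ∘ e.symm) := by
  intro m hm hm'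
  refine Eq.trans ?_ (hx ((e.symm.trans m).trans e) (by simp [hm]) (fun k => by
    simpa [← Equiv.eq_symm_apply] using hm' (e.symm k)))
  refine Fintype.sum_equiv (e.arrowCongr (Equiv.refl _)) _ _ fun j => ?_
  congr 2
  simp only [funext_iff, eq_iff_iff]
  conv_rhs => rw [← e.forall_congr_right]
  simp [Equiv.arrowCongr]

lemma sum_mul_col_of_mem_orthogonalGroup {g : Matrix (Fin d) (Fin d) ℝ}
    (hg : g ∈ Matrix.orthogonalGroup (Fin d) ℝ) (a b : Fin d) :
    ∑ c, g a c * g b c = if a = b then 1 else 0 := by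
  have h := congrFun₂ ((Matrix.mem_orthogonalGroup_iff (Fin d) ℝ).1 hg) a b
  simpa [Matrix.mul_apply, Matrix.one_apply] using h

lemma sum_mul_row_of_mem_orthogonalGroup {g : Matrix (Fin d) (Fin d) ℝ}
    (hg : g ∈ Matrix.orthogonalGroup (Fin d) ℝ) (a b : Fin d) :
    ∑ c, g c a * g c b = if a = b then 1 else 0 := by
  have h := congrFun₂ ((Matrix.mem_orthogonalGroup_iff' (Fin d) ℝ).1 hg) a b
  simpa [Matrix.mul_apply, Matrix.one_apply] using h

lemma sum_bool_sum_arrow (F : (Bool ⊕ κ → Fin d) → ℝ) :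
    ∑ i, F i = ∑ a, ∑ b, ∑ j : κ → Fin d, F (Sum.elim (fun t => cond t b a) j) := by
  rw [← (Equiv.sumArrowEquivProdArrow Bool κ (Fin d)).symm.sum_comp, Fintype.sum_prod_type,
    ← (Equiv.boolArrowEquivProd (Fin d)).symm.sum_comp, Fintype.sum_prod_type]
  refine Finset.sum_congr rfl fun a _ => Finset.sum_congr rfl fun b _ =>
    Finset.sum_congr rfl fun j _ => congrArg F ?_
  funext t
  rcases t with (_ | _) | t <;> rfl

lemma IsOrthInvariant.contract {x : (Bool ⊕ κ → Fin d) → ℝ} (hx : IsOrthInvariant x) :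
    IsOrthInvariant fun j : κ → Fin d => ∑ c, x (Sum.elim (fun _ => c) j) := by
  intro g hg i
  have key : ∀ c, x (Sum.elim (fun _ => c) i) = ∑ a, ∑ b, ∑ j : κ → Fin d,
      (g c a * g c b) * ((∏ k, g (i k) (j k)) * x (Sum.elim (fun t => cond t b a) j)) := by
    intro c
    rw [← hx g hg (Sum.elim (fun _ => c) i), sum_bool_sum_arrow]
    refine Finset.sum_congr rfl fun a _ => Finset.sum_congr rfl fun b _ =>
      Finset.sum_congr rfl fun j _ => ?_
    simp [Fintype.prod_sum_type]
    ring
  have collect : ∑ c, x (Sum.elim (fun _ => c) i) = ∑ a, ∑ b, ∑ j : κ → Fin d,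
      if a = b then (∏ k, g (i k) (j k)) * x (Sum.elim (fun t => cond t b a) j) else 0 := by
    simp_rw [key]
    rw [Finset.sum_comm]
    refine Finset.sum_congr rfl fun a _ => ?_
    rw [Finset.sum_comm]
    refine Finset.sum_congr rfl fun b _ => ?_
    rw [Finset.sum_comm]
    refine Finset.sum_congr rfl fun j _ => ?_
    rw [← Finset.sum_mul, sum_mul_row_of_mem_orthogonalGroup hg, ite_mul, one_mul, zero_mul]
  change _ = ∑ c, x (Sum.elim (fun _ => c) i)
  rw [collect]
  simp_rw [Finset.mul_sum]
  rw [Finset.sum_comm]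
  refine Finset.sum_congr rfl fun a _ => ?_
  rw [Finset.sum_comm]
  exact Finset.sum_congr rfl fun j _ => by simp

lemma IsOrthogonalToMatchings.contract {x : (Bool ⊕ κ → Fin d) → ℝ}
    (hx : IsOrthogonalToMatchings x) :
    IsOrthogonalToMatchings fun j : κ → Fin d => ∑ c, x (Sum.elim (fun _ => c) j) := by
  intro m hm hm'
  have h := hx (Equiv.sumCongr Equiv.boolNot m) (by rintro (_ | _) <;> simp [hm])
    (by rintro (_ | _) <;> simp [hm'])
  rw [sum_bool_sum_arrow] at h
  refine Eq.trans ?_ h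
  simp_rw [Finset.mul_sum]
  rw [Finset.sum_comm]
  refine Finset.sum_congr rfl fun a _ => ?_
  conv_rhs => rw [Finset.sum_comm]
  refine Finset.sum_congr rfl fun j _ => ?_
  have hiff : ∀ b : Fin d, (Sum.elim (fun t => cond t b a) j ∘ Equiv.sumCongr Equiv.boolNot m
      = (Sum.elim (fun t => cond t b a) j : Bool ⊕ κ → Fin d)) ↔ (a = b ∧ j ∘ m = j) := by
    intro b
    simp only [funext_iff, Sum.forall, Bool.forall_bool]
    simp
    intro _ h
    exact h.symm
  simp only [hiff, ite_and]
  simp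

lemma IsOrthInvariant.even_card {x : (ι → Fin d) → ℝ} (hx : IsOrthInvariant x)
    {i : ι → Fin d} (hi : x i ≠ 0) (a : Fin d) :
    Even (Finset.univ.filter fun k => i k = a).card := by
  let s : Fin d → ℝ := fun b => if b = a then -1 else 1
  have hs : Matrix.diagonal s ∈ Matrix.orthogonalGroup (Fin d) ℝ := by
    rw [Matrix.mem_orthogonalGroup_iff]
    rw [← Matrix.diagonal_one]
    simp only [Matrix.diagonal_transpose, Matrix.diagonal_mul_diagonal]
    congr 1
    funext b
    by_cases hb : b = a <;> simp [s, hb]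
  have h := hx _ hs i
  rw [Finset.sum_eq_single i] at h
  · simp only [Matrix.diagonal_apply_eq, s, Finset.prod_ite, Finset.prod_const, one_pow,
      mul_one] at h
    by_contra hodd
    rw [Nat.not_even_iff_odd] at hodd
    rw [hodd.neg_one_pow] at h
    exact hi (by linarith)
  · intro j _ hj
    obtain ⟨k, hk⟩ := Function.ne_iff.1 hj
    rw [Finset.prod_eq_zero (Finset.mem_univ k) (Matrix.diagonal_apply_ne s hk.symm), zero_mul]
  · simp

lemma sum_agree_off_eq_sum_update (F : (ι → Fin d) → ℝ) (i : ι → Fin d) (k : ι) :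
    ∑ j : ι → Fin d, (if ∀ l, l ≠ k → i l = j l then F j else 0)
      = ∑ c, F (Function.update i k c) := by
  rw [← Finset.sum_filter]
  refine Finset.sum_nbij' (fun j => j k) (fun c => Function.update i k c) ?_ ?_ ?_ ?_ ?_
  · simp
  · intro c _
    simp only [Finset.mem_filter, Finset.mem_univ, true_and]
    intro l hl
    simp [hl]
  · intro j hj
    simp only [Finset.mem_filter, Finset.mem_univ, true_and] at hj
    funext l
    by_cases hl : l = k
    · subst hl; simp
    · simp [hl, hj l hl]
  · simp
  · intro j hj
    simp only [Finset.mem_filter, Finset.mem_univ, true_and] at hj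
    congr 1
    funext l
    by_cases hl : l = k
    · subst hl; simp
    · simp [hl, hj l hl]

/-- The rotation by angle `t` in the plane spanned by the basis vectors `a` and `b`. -/
noncomputable def planeRotation (a b : Fin d) (t : ℝ) : Matrix (Fin d) (Fin d) ℝ :=
  1 + (Real.cos t - 1) • (Matrix.single a a 1 + Matrix.single b b 1)
    + Real.sin t • (Matrix.single a b 1 - Matrix.single b a 1)

lemma planeRotation_mem {a b : Fin d} (hab : a ≠ b) (t : ℝ) :
    planeRotation a b t ∈ Matrix.orthogonalGroup (Fin d) ℝ := by
  rw [Matrix.mem_orthogonalGroup_iff]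
  have h1 := Real.sin_sq_add_cos_sq t
  have h2 : (planeRotation a b t).transpose =
      1 + (Real.cos t - 1) • (Matrix.single a a 1 + Matrix.single b b 1)
        - Real.sin t • (Matrix.single a b 1 - Matrix.single b a 1) := by
    simp only [planeRotation, Matrix.transpose_add, Matrix.transpose_sub,
      Matrix.transpose_smul, Matrix.transpose_one, Matrix.transpose_single]
    module
  have hD : (Matrix.single a a 1 + Matrix.single b b 1 : Matrix (Fin d) (Fin d) ℝ)
      * (Matrix.single a a 1 + Matrix.single b b 1)
      = Matrix.single a a 1 + Matrix.single b b 1 := by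
    simp [mul_add, add_mul, hab, hab.symm]
  have hX : (Matrix.single a b 1 - Matrix.single b a 1 : Matrix (Fin d) (Fin d) ℝ)
      * (Matrix.single a b 1 - Matrix.single b a 1)
      = -(Matrix.single a a 1 + Matrix.single b b 1) := by
    simp [mul_sub, sub_mul, hab, hab.symm]
    abel
  have hDX : (Matrix.single a a 1 + Matrix.single b b 1 : Matrix (Fin d) (Fin d) ℝ)
      * (Matrix.single a b 1 - Matrix.single b a 1)
      = Matrix.single a b 1 - Matrix.single b a 1 := by
    simp [mul_sub, add_mul, hab, hab.symm]
  have hXD : (Matrix.single a b 1 - Matrix.single b a 1 : Matrix (Fin d) (Fin d) ℝ)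
      * (Matrix.single a a 1 + Matrix.single b b 1)
      = Matrix.single a b 1 - Matrix.single b a 1 := by
    simp [sub_mul, mul_add, hab, hab.symm]
    abel
  have expand : ∀ (D X : Matrix (Fin d) (Fin d) ℝ) (u v : ℝ), D * D = D → X * X = -D →
      D * X = X → X * D = X →
      (1 + u • D + v • X) * (1 + u • D - v • X) = 1 + (2 * u + u ^ 2 + v ^ 2) • D := by
    intro D X u v hD hX hDX hXD
    simp only [mul_sub, mul_add, add_mul, mul_one, one_mul, smul_mul_assoc, mul_smul_comm, hD, hX,
      hDX, hXD]
    module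
  rw [h2, planeRotation, expand _ _ _ _ hD hX hDX hXD]
  have : 2 * (Real.cos t - 1) + (Real.cos t - 1) ^ 2 + Real.sin t ^ 2 = 0 := by linarith
  rw [this, zero_smul, add_zero]

lemma hasDerivAt_planeRotation (a b p q : Fin d) :
    HasDerivAt (fun t => planeRotation a b t p q)
      ((if p = a ∧ q = b then 1 else 0) - (if p = b ∧ q = a then 1 else 0)) 0 := by
  have hc : HasDerivAt (fun t => Real.cos t - 1) 0 0 := by
    simpa using (Real.hasDerivAt_cos 0).sub_const 1
  have hs : HasDerivAt Real.sin 1 0 := by simpa using Real.hasDerivAt_sin 0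
  have h : HasDerivAt (fun t => planeRotation a b t p q) _ 0 := ((hc.mul_const ((Matrix.single a a 1 + Matrix.single b b 1 :
    Matrix (Fin d) (Fin d) ℝ) p q)).const_add ((1 : Matrix (Fin d) (Fin d) ℝ) p q)).add
    (hs.mul_const ((Matrix.single a b 1 - Matrix.single b a 1 : Matrix (Fin d) (Fin d) ℝ) p q))
  refine h.congr_deriv ?_
  simp [Matrix.single_apply, eq_comm]

lemma planeRotation_zero (a b : Fin d) : planeRotation a b 0 = 1 := by simp [planeRotation]

lemma IsOrthInvariant.unitAction_comm {x : (ι → Fin d) → ℝ} (hx : IsOrthInvariant x)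
    {a b : Fin d} (hab : a ≠ b) (i : ι → Fin d) :
    unitAction a b x i = unitAction b a x i := by
  have h : HasDerivAt (fun t => ∑ j : ι → Fin d, (∏ k, planeRotation a b t (i k) (j k)) * x j)
      (∑ j : ι → Fin d, (∑ k, (∏ l ∈ Finset.univ.erase k, planeRotation a b 0 (i l) (j l)) •
        ((if i k = a ∧ j k = b then 1 else 0) - (if i k = b ∧ j k = a then 1 else 0))) * x j)
      0 :=
    HasDerivAt.fun_sum fun j _ => HasDerivAt.mul_const
      (HasDerivAt.fun_finsetProd fun k _ => hasDerivAt_planeRotation a b (i k) (j k)) _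
  have h' : HasDerivAt (fun t => ∑ j : ι → Fin d, (∏ k, planeRotation a b t (i k) (j k)) * x j)
      0 0 :=
    (hasDerivAt_const 0 (x i)).congr_of_eventuallyEq
      (.of_forall fun t => hx _ (planeRotation_mem hab t) i)
  have h0 := h.unique h'
  rw [← sub_eq_zero]
  refine Eq.trans ?_ h0
  simp_rw [Finset.sum_mul]
  rw [Finset.sum_comm, unitAction, unitAction, ← Finset.sum_sub_distrib]
  refine Finset.sum_congr rfl fun k _ => ?_
  have h1 := sum_agree_off_eq_sum_update (fun j => ((if i k = a ∧ j k = b then 1 else 0)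
    - (if i k = b ∧ j k = a then 1 else 0)) * x j) i k
  trans ∑ c, (((if i k = a ∧ c = b then 1 else 0) - (if i k = b ∧ c = a then 1 else 0)) *
    x (Function.update i k c))
  · simp [ite_and, sub_mul, Finset.sum_sub_distrib, Finset.sum_ite_irrel]
  · simp only [Function.update_self] at h1
    rw [← h1]
    refine Finset.sum_congr rfl fun j _ => ?_
    simp only [planeRotation_zero, Matrix.one_apply, Finset.prod_ite_zero, Finset.prod_const_one]
    simp [ite_mul]

lemma sum_mul_unitAction (a b : Fin d) (x y : (ι → Fin d) → ℝ) :
    ∑ i, x i * unitAction a b y i = ∑ i, unitAction b a x i * y i := by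
  simp_rw [unitAction, Finset.mul_sum, Finset.sum_mul]
  rw [Finset.sum_comm]
  conv_rhs => rw [Finset.sum_comm]
  refine Finset.sum_congr rfl fun k _ => ?_
  simp only [mul_ite, ite_mul, mul_zero, zero_mul, ← Finset.sum_filter]
  refine Finset.sum_nbij' (fun i => Function.update i k b) (fun i => Function.update i k a)
    ?_ ?_ ?_ ?_ ?_
  · simp
  · simp
  · simp +contextual [eq_comm]
  · simp +contextual [eq_comm]
  · simp +contextual [eq_comm]

lemma sum_unitAction_unitAction {x : (ι → Fin d) → ℝ}
    (hx : ∀ k l, k ≠ l → ∀ i, ∑ c, x (Function.update (Function.update i k c) l c) = 0)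
    (i : ι → Fin d) :
    ∑ a, ∑ b, unitAction a b (unitAction a b x) i = Fintype.card ι * x i := by
  have hterm : ∀ k l, ∑ a, ∑ b, (if i k = a then (if Function.update i k b l = a then
      x (Function.update (Function.update i k b) l b) else 0) else 0)
      = if k = l then x i else 0 := by
    intro k l
    by_cases hkl : k = l
    · subst hkl
      simp [Finset.sum_ite_irrel]
    · simp only [Function.update_of_ne (Ne.symm hkl), if_neg hkl, Finset.sum_ite_irrel]
      simp [hx k l hkl]
  calc _ = ∑ k, ∑ l, ∑ a, ∑ b, (if i k = a then (if Function.update i k b l = a then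
      x (Function.update (Function.update i k b) l b) else 0) else 0) := by
        simp_rw [unitAction]
        conv_rhs =>
          enter [2, k]
          rw [Finset.sum_comm]
          enter [2, a]
          rw [Finset.sum_comm]
        conv_rhs => rw [Finset.sum_comm]
        refine Finset.sum_congr rfl fun a _ => ?_
        conv_rhs => rw [Finset.sum_comm]
        refine Finset.sum_congr rfl fun b _ => Finset.sum_congr rfl fun k _ => ?_
        split_ifs <;> simp
    _ = _ := by simp_rw [hterm]; simp

lemma unitAction_self (a : Fin d) (x : (ι → Fin d) → ℝ) (i : ι → Fin d) :
    unitAction a a x i = (Finset.univ.filter fun k => i k = a).card * x i := by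
  rw [unitAction, ← Finset.sum_filter, Finset.sum_congr rfl (g := fun _ => x i)]
  · simp
  · intro k hk
    rw [← (Finset.mem_filter.1 hk).2, Function.update_eq_self]

lemma IsOrthInvariant.eq_zero_of_traceless [Nonempty ι] {x : (ι → Fin d) → ℝ}
    (hx : IsOrthInvariant x)
    (htr : ∀ k l, k ≠ l → ∀ i, ∑ c, x (Function.update (Function.update i k c) l c) = 0) :
    x = 0 := by
  have hsymm : ∀ a b, unitAction a b x = unitAction b a x := fun a b => by
    by_cases hab : a = b
    · rw [hab]
    · exact funext (hx.unitAction_comm hab)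
  have hnorm : Fintype.card ι * ∑ i, x i ^ 2 = ∑ a, ∑ b, ∑ i, unitAction a b x i ^ 2 := by
    calc _ = ∑ i, x i * ∑ a, ∑ b, unitAction a b (unitAction a b x) i := by
          simp_rw [sum_unitAction_unitAction htr, Finset.mul_sum]
          exact Finset.sum_congr rfl fun i _ => by ring
      _ = ∑ a, ∑ b, ∑ i, x i * unitAction a b (unitAction a b x) i := by
          simp_rw [Finset.mul_sum]
          rw [Finset.sum_comm]
          exact Finset.sum_congr rfl fun a _ => Finset.sum_comm
      _ = _ := by
          simp_rw [sum_mul_unitAction _ _ x]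
          refine Finset.sum_congr rfl fun a _ => Finset.sum_congr rfl fun b _ => ?_
          exact Finset.sum_congr rfl fun i _ => by rw [hsymm b a, sq]
  have hdiag : ∑ a, ∑ i, unitAction a a x i ^ 2 ≤ ∑ a, ∑ b, ∑ i, unitAction a b x i ^ 2 :=
    Finset.sum_le_sum fun a _ => Finset.single_le_sum
      (f := fun b => ∑ i, unitAction a b x i ^ 2)
      (fun b _ => Finset.sum_nonneg fun i _ => sq_nonneg _) (Finset.mem_univ a)
  have hweight : 2 * (Fintype.card ι * ∑ i, x i ^ 2) ≤ ∑ a, ∑ i, unitAction a a x i ^ 2 := by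
    rw [Finset.sum_comm, Finset.mul_sum, Finset.mul_sum]
    refine Finset.sum_le_sum fun i _ => ?_
    rw [← sum_card_fiber i, Finset.sum_mul, Finset.mul_sum]
    refine Finset.sum_le_sum fun a _ => ?_
    rw [unitAction_self, mul_pow, ← mul_assoc]
    by_cases hi : x i = 0
    · simp [hi]
    refine mul_le_mul_of_nonneg_right ?_ (sq_nonneg _)
    obtain ⟨r, hr⟩ := hx.even_card hi a
    rw [hr]
    have : 2 * (r + r) ≤ (r + r) ^ 2 := by nlinarith [Nat.le_self_pow (two_ne_zero) r]
    exact_mod_cast this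
  have hcard : (0 : ℝ) < Fintype.card ι := by exact_mod_cast Fintype.card_pos
  have hzero : ∑ i, x i ^ 2 ≤ 0 := by
    have : Fintype.card ι * ∑ i, x i ^ 2 ≤ 0 := by linarith
    nlinarith
  have hzero' := (Finset.sum_eq_zero_iff_of_nonneg fun i _ => sq_nonneg (x i)).1
    (le_antisymm hzero (Finset.sum_nonneg fun i _ => sq_nonneg (x i)))
  exact funext fun i => by simpa using hzero' i (Finset.mem_univ i)

end Tensor

section FirstFundamentalTheorem

variable {d : ℕ}

theorem IsOrthInvariant.eq_zero_of_isOrthogonalToMatchings {ι : Type} [Fintype ι] [DecidableEq ι]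
    {x : (ι → Fin d) → ℝ} (hx : IsOrthInvariant x) (hm : IsOrthogonalToMatchings x) : x = 0 := by
  induction hN : Fintype.card ι using Nat.strong_induction_on generalizing ι with
  | _ N ih =>
    rcases isEmpty_or_nonempty ι with hι | hι
    · have h := hm 1 (fun k => hι.elim k) (fun k => hι.elim k)
      funext i
      simpa [Subsingleton.elim default i] using h
    refine hx.eq_zero_of_traceless fun k l hkl i => ?_
    obtain ⟨e, he⟩ := exists_boolSum_equiv hkl
    have hcard : Fintype.card {t : ι // t ≠ k ∧ t ≠ l} < N := by
      rw [← hN]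
      exact Fintype.card_subtype_lt (x := k) (by simp)
    have h := congrFun (ih _ hcard (hx.comp_equiv e).contract (hm.comp_equiv e).contract rfl)
      (fun t => i t.1)
    rw [Pi.zero_apply] at h
    refine Eq.trans (Finset.sum_congr rfl fun c _ => congrArg x ?_) h
    funext t
    obtain ⟨s, rfl⟩ := e.surjective t
    rcases s with (_ | _) | ⟨t, ht⟩
    · have hk : e (Sum.inl false) = k := he _
      rw [Function.comp_apply, e.symm_apply_apply, hk]
      simp [hkl]
    · have hl : e (Sum.inl true) = l := he _
      rw [Function.comp_apply, e.symm_apply_apply, hl]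
      simp
    · simp only [Function.comp_apply, e.symm_apply_apply]
      simp [he, ht.1, ht.2]

/-- The tensor of the matching of `κ ⊕ κ` that pairs the two copies of `κ` is invariant. -/
lemma isOrthInvariant_sumSwap {κ : Type} [Fintype κ] [DecidableEq κ] :
    IsOrthInvariant fun i : κ ⊕ κ → Fin d => if i ∘ Sum.swap = i then (1 : ℝ) else 0 := by
  have hiff : ∀ u v : κ → Fin d, (Sum.elim u v ∘ Sum.swap = Sum.elim u v) ↔ u = v := by
    intro u v
    simp only [funext_iff, Sum.forall]
    simp
    exact fun h k => (h k).symm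
  intro g hg i
  obtain ⟨⟨u, v⟩, rfl⟩ := (Equiv.sumArrowEquivProdArrow κ κ (Fin d)).symm.surjective i
  rw [← (Equiv.sumArrowEquivProdArrow κ κ (Fin d)).symm.sum_comp, Fintype.sum_prod_type]
  simp only [Equiv.sumArrowEquivProdArrow, Equiv.coe_fn_symm_mk, hiff, Fintype.prod_sum_type,
    Sum.elim_inl, Sum.elim_inr, mul_ite, mul_one, mul_zero, Finset.sum_ite_eq, Finset.mem_univ,
    if_true, ← Finset.prod_mul_distrib]
  rw [← Fintype.prod_sum (fun k c => g (u k) c * g (v k) c)]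
  simp [sum_mul_col_of_mem_orthogonalGroup hg, Finset.prod_ite_zero, funext_iff]

lemma isOrthInvariant_rho {N : ℕ} (m : Matchings N) : IsOrthInvariant (rho d N m) := by
  obtain ⟨m, hm, hm'⟩ := m
  let κ := {k : Fin N // k < m k}
  let e : κ ⊕ κ ≃ Fin N := Equiv.ofBijective (Sum.elim (fun k => k.1) fun k => m k.1) <| by
    refine ⟨Function.Injective.sumElim Subtype.val_injective
      (m.injective.comp Subtype.val_injective) ?_, ?_⟩
    · rintro ⟨k, hk⟩ ⟨l, hl⟩ (rfl : k = m l)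
      rw [hm] at hk
      exact lt_asymm hk hl
    · intro k
      rcases lt_or_gt_of_ne (hm' k) with h | h
      · exact ⟨Sum.inr ⟨m k, by simpa [hm] using h⟩, hm k⟩
      · exact ⟨Sum.inl ⟨k, h⟩, rfl⟩
  have he : ∀ s, m (e s) = e s.swap := by
    rintro (s | s)
    · rfl
    · exact hm s.1
  convert (isOrthInvariant_sumSwap (d := d) (κ := κ)).comp_equiv e.symm using 1
  funext i
  have hiff : i ∘ m = i ↔ (i ∘ e) ∘ Sum.swap = i ∘ e := by
    simp only [funext_iff]
    rw [← e.forall_congr_right]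
    simp [he]
  simp only [rho, hiff]
  rfl

lemma IsOrthInvariant.sub {ι : Type} [Fintype ι] [DecidableEq ι] {x y : (ι → Fin d) → ℝ}
    (hx : IsOrthInvariant x) (hy : IsOrthInvariant y) : IsOrthInvariant (x - y) := by
  intro g hg i
  simp [mul_sub, Finset.sum_sub_distrib, hx g hg i, hy g hg i]

lemma isOrthInvariant_of_mem_span_rho {N : ℕ} {x : (Fin N → Fin d) → ℝ}
    (hx : x ∈ Submodule.span ℝ (Set.range (rho d N))) : IsOrthInvariant x := by
  induction hx using Submodule.span_induction with
  | mem x hx =>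
    obtain ⟨m, rfl⟩ := hx
    exact isOrthInvariant_rho m
  | zero => intro g _ i; simp
  | add x y _ _ hx hy =>
    intro g hg i
    simp [mul_add, Finset.sum_add_distrib, hx g hg i, hy g hg i]
  | smul c x _ hx =>
    intro g hg i
    simp only [Pi.smul_apply, smul_eq_mul, mul_left_comm _ c]
    rw [← Finset.mul_sum, hx g hg i]

lemma mem_span_rho_of_isOrthInvariant {N : ℕ} {x : (Fin N → Fin d) → ℝ} (hx : IsOrthInvariant x) :
    x ∈ Submodule.span ℝ (Set.range (rho d N)) := by
  let L := WithLp.linearEquiv 2 ℝ ((Fin N → Fin d) → ℝ)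
  let W : Submodule ℝ (EuclideanSpace ℝ (Fin N → Fin d)) :=
    (Submodule.span ℝ (Set.range (rho d N))).comap L.toLinearMap
  obtain ⟨w, hw, z, hz, hwz⟩ := W.exists_add_mem_mem_orthogonal (L.symm x)
  have hxw : x = L w + L z := by
    rw [← map_add, ← hwz, L.apply_symm_apply]
  have hw' : L w ∈ Submodule.span ℝ (Set.range (rho d N)) := hw
  have hinv : IsOrthInvariant (L z) := by
    rw [eq_sub_of_add_eq' hxw.symm]
    exact hx.sub (isOrthInvariant_of_mem_span_rho hw')
  have horth : IsOrthogonalToMatchings (L z) := by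
    intro m hm hm'
    have h := hz (L.symm (rho d N ⟨m, hm, hm'⟩)) (by
      change L (L.symm _) ∈ Submodule.span ℝ (Set.range (rho d N))
      rw [L.apply_symm_apply]
      exact Submodule.subset_span ⟨_, rfl⟩)
    rw [PiLp.inner_apply] at h
    refine Eq.trans (Finset.sum_congr rfl fun i _ => ?_) h
    change rho d N ⟨m, hm, hm'⟩ i * z.ofLp i = z.ofLp i * rho d N _ i
    exact mul_comm _ _
  rw [hxw, hinv.eq_zero_of_isOrthogonalToMatchings horth, add_zero]
  exact hw'

end FirstFundamentalTheorem

theorem stmt3 (d n : ℕ) (hd : 0 < d) (hn : 0 < n) :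
    (∀ x : (Fin (2*n) → Fin d) → ℝ,
      (∀ g : OrthGroup d, ∀ i : Fin (2*n) → Fin d,
        (∑ j : Fin (2*n) → Fin d,
          (∏ k, ((g : Matrix (Fin d) (Fin d) ℝ) (i k) (j k))) * x j) = x i)
        ↔ x ∈ Submodule.span ℝ (Set.range (rho d (2*n)))) ∧
    (∀ x : (Fin (2*n+1) → Fin d) → ℝ,
      (∀ g : OrthGroup d, ∀ i : Fin (2*n+1) → Fin d,
        (∑ j : Fin (2*n+1) → Fin d,
          (∏ k, ((g : Matrix (Fin d) (Fin d) ℝ) (i k) (j k))) * x j) = x i)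
        → x = 0) := by
  refine ⟨fun x => ⟨fun h => mem_span_rho_of_isOrthInvariant fun g hg => h ⟨g, hg⟩,
    fun h g => isOrthInvariant_of_mem_span_rho h g g.2⟩, fun x h => ?_⟩
  refine IsOrthInvariant.eq_zero_of_isOrthogonalToMatchings (fun g hg => h ⟨g, hg⟩)
    fun m hm hm' => ?_
  have h2 : m ^ 2 = 1 := by
    ext k
    simp [sq, hm]
  obtain ⟨k, hk⟩ := Equiv.Perm.exists_fixed_point_of_prime (p := 2) (n := 1) (σ := m)
    (by rw [Fintype.card_fin]; omega) (by simpa using h2)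
  exact absurd hk (hm' k)
end

section
/- Let d and n be positive integers with d ≥ n. Then the family of vectors (ρ(𝔪))_{𝔪 ∈ M(2n)} in ℝ^{Fin (2n) → Fin d} is linearly independent. -/
/-- At most half of the points are the smaller element of their pair. -/
lemma IsPairMatching.two_mul_card_lt_le {N : ℕ} {m : Equiv.Perm (Fin N)}
    (hm : IsPairMatching m) : 2 * Fintype.card {x : Fin N // x < m x} ≤ N := by
  have hdisj : Disjoint (Finset.univ.filter fun x => x < m x)
      ((Finset.univ.filter fun x => x < m x).map m.toEmbedding) := by
    rw [Finset.disjoint_left]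
    intro x hx hx'
    obtain ⟨y, hy, rfl⟩ := Finset.mem_map.1 hx'
    simp only [Finset.mem_filter, Finset.mem_univ, true_and, Equiv.coe_toEmbedding,
      hm.1 y] at hx hy
    exact lt_asymm hx hy
  have hcard := Finset.card_le_univ (Finset.disjUnion _ _ hdisj)
  rw [Finset.card_disjUnion, Finset.card_map, Fintype.card_fin] at hcard
  rw [Fintype.card_subtype]
  omega

/-- With enough colours, the pairs of a matching can be given pairwise distinct colours. -/
lemma IsPairMatching.exists_coloring {d n : ℕ} (hdn : n ≤ d) {m : Equiv.Perm (Fin (2 * n))}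
    (hm : IsPairMatching m) :
    ∃ i : Fin (2 * n) → Fin d, ∀ x y, i x = i y ↔ y = x ∨ y = m x := by
  have hcard : Fintype.card {x : Fin (2 * n) // x < m x} ≤ Fintype.card (Fin d) := by
    have := hm.two_mul_card_lt_le
    rw [Fintype.card_fin]
    omega
  obtain ⟨e⟩ := Function.Embedding.nonempty_of_card_le hcard
  have hmin (x) : min x (m x) < m (min x (m x)) := by
    rcases lt_or_gt_of_ne (hm.2 x) with h | h
    · rwa [min_eq_right h.le, hm.1]
    · rwa [min_eq_left h.le]
  refine ⟨fun x => e ⟨min x (m x), hmin x⟩, fun x y => ?_⟩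
  rw [e.injective.eq_iff, Subtype.mk.injEq]
  constructor
  · intro h
    have hx := hm.1 x
    have hy := hm.1 y
    rcases min_choice x (m x) with h₁ | h₁ <;> rcases min_choice y (m y) with h₂ | h₂ <;>
      grind
  · rintro (rfl | rfl)
    · rfl
    · rw [hm.1, min_comm]

theorem stmt5 (d n : ℕ) (hd : 0 < d) (hn : 0 < n) (hdn : d ≥ n) :
    LinearIndependent ℝ (fun m : Matchings (2*n) => rho d (2*n) m) := by
  rw [Fintype.linearIndependent_iff]
  intro g hg m
  obtain ⟨i, hi⟩ := m.2.exists_coloring hdn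
  have hrho (m' : Matchings (2 * n)) (hne : m' ≠ m) : rho d (2 * n) m' i = 0 := by
    refine if_neg fun h => hne (Subtype.ext (Equiv.ext fun x => ?_))
    exact ((hi x (m'.1 x)).1 (congrFun h x).symm).resolve_left (m'.2.2 x)
  have hself : rho d (2 * n) m i = 1 :=
    if_pos (funext fun x => ((hi x (m.1 x)).2 (Or.inr rfl)).symm)
  have hsum := congrFun hg i
  rw [Finset.sum_apply, Finset.sum_eq_single m
    (fun m' _ hne => by rw [Pi.smul_apply, hrho m' hne, smul_zero])
    (fun h => absurd (Finset.mem_univ m) h)] at hsum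
  simpa [hself] using hsum
end

section
/- Let d and n be positive integers with d ≥ n. Then the Gram matrix G_n^{O(d)}, the real matrix indexed by M(2n) with entries G(𝔪,𝔫) = d^{loop(𝔪,𝔫)}, is invertible. -/
open Equiv Equiv.Perm

/-- The setoid identifying `x` with `τ x`, for an involution `τ`. -/
def involutionSetoid {α : Type*} (τ : α → α) (hτ : Function.Involutive τ) : Setoid α where
  r x y := y = x ∨ y = τ x
  iseqv :=
    { refl := fun _ => Or.inl rfl
      symm := by
        rintro x y (rfl | rfl)
        · exact Or.inl rfl
        · exact Or.inr (hτ x).symm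
      trans := by
        rintro x y z (rfl | rfl) (rfl | rfl)
        · exact Or.inl rfl
        · exact Or.inr rfl
        · exact Or.inr rfl
        · exact Or.inl (hτ x) }

theorem card_eq_two_mul_card_quotient_involutionSetoid {α : Type*} [Finite α] (τ : α → α)
    (hτ : Function.Involutive τ) (hne : ∀ x, τ x ≠ x) :
    Nat.card α = 2 * Nat.card (Quotient (involutionSetoid τ hτ)) := by
  classical
  have := Fintype.ofFinite α
  have := Fintype.ofFinite (Quotient (involutionSetoid τ hτ))
  have hfib : ∀ q : Quotient (involutionSetoid τ hτ),
      (Finset.univ.filter fun x : α => Quotient.mk _ x = q).card = 2 := by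
    intro q
    induction q using Quotient.inductionOn with
    | h x =>
      rw [Finset.card_eq_two]
      refine ⟨x, τ x, (hne x).symm, ?_⟩
      ext y
      simp only [Finset.mem_filter, Finset.mem_univ, true_and, Finset.mem_insert,
        Finset.mem_singleton]
      rw [eq_comm, Quotient.eq]
      rfl
  rw [Nat.card_eq_fintype_card, Nat.card_eq_fintype_card, ← Finset.card_univ,
    Finset.card_eq_sum_card_fiberwise (f := Quotient.mk (involutionSetoid τ hτ))
      (t := Finset.univ) (fun _ _ => Finset.mem_coe.2 (Finset.mem_univ _)),
    Finset.sum_congr rfl (fun q _ => hfib q)]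
  simp [mul_comm]

theorem cycleCount_eq_card_quotient {N : ℕ} (σ : Perm (Fin N)) :
    cycleCount σ = Nat.card (Quotient (SameCycle.setoid σ)) := by
  classical
  have hex : ∀ c : σ.cycleFactorsFinset, ∃ x, x ∈ c.1.support := fun c =>
    (mem_cycleFactorsFinset_iff.1 c.2).1.nonempty_support
  choose r hr using hex
  have hcyc : ∀ c : σ.cycleFactorsFinset, c.1 = σ.cycleOf (r c) := fun c =>
    cycle_is_cycleOf (hr c) c.2
  have hmoved : ∀ c : σ.cycleFactorsFinset, σ (r c) ≠ r c := fun c =>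
    mem_support.1 (mem_cycleFactorsFinset_support_le c.2 (hr c))
  let φ : σ.cycleFactorsFinset ⊕ {x // σ x = x} → Quotient (SameCycle.setoid σ) :=
    Sum.elim (fun c => Quotient.mk _ (r c)) (fun x => Quotient.mk _ x.1)
  have hφ : Function.Bijective φ := by
    constructor
    · rintro (c | x) (c' | x') h
      · have h : SameCycle σ (r c) (r c') := Quotient.exact h
        exact congrArg Sum.inl (Subtype.ext (by rw [hcyc c, hcyc c', h.cycleOf_eq]))
      · have h : SameCycle σ (r c) x'.1 := Quotient.exact h
        exact absurd (h.apply_eq_self_iff.2 x'.2) (hmoved c)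
      · have h : SameCycle σ x.1 (r c') := Quotient.exact h
        exact absurd (h.apply_eq_self_iff.1 x.2) (hmoved c')
      · have h : SameCycle σ x.1 x'.1 := Quotient.exact h
        exact congrArg Sum.inr (Subtype.ext (h.eq_of_left x.2))
    · intro q
      induction q using Quotient.inductionOn with
      | h x =>
        by_cases hx : σ x = x
        · exact ⟨Sum.inr ⟨x, hx⟩, rfl⟩
        · let c : σ.cycleFactorsFinset :=
            ⟨σ.cycleOf x, cycleOf_mem_cycleFactorsFinset_iff.2 (mem_support.2 hx)⟩
          have h : SameCycle σ x (r c) := (mem_support_cycleOf_iff.1 (hr c)).1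
          exact ⟨Sum.inl c, Quotient.sound h.symm⟩
  rw [← Nat.card_eq_of_bijective φ hφ, Nat.card_sum, cycleCount, cycleType_def, Multiset.card_map]
  congr 1
  · simp
  · rw [Nat.card_eq_fintype_card, Fintype.card_subtype]

section Involutions

variable {α : Type*} {m p : Perm α}

theorem apply_mul_zpow_apply (hm : Function.Involutive m) (hp : Function.Involutive p) (k : ℤ)
    (x : α) : p (((m * p) ^ k) x) = ((m * p) ^ (-k)) (p x) := by
  have hm' : m⁻¹ = m := inv_eq_of_mul_eq_one_left (Equiv.ext hm)
  have hp' : p⁻¹ = p := inv_eq_of_mul_eq_one_left (Equiv.ext hp)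
  have h : p * (m * p) * p⁻¹ = (m * p)⁻¹ := by
    rw [mul_inv_rev, hm', hp', mul_assoc, mul_assoc, (Equiv.ext hp : p * p = 1), mul_one]
  have h' : p * (m * p) ^ k = (m * p) ^ (-k) * p := by
    rw [zpow_neg, ← inv_zpow, ← h, conj_zpow, inv_mul_cancel_right]
  exact congrArg (fun g : Perm α => g x) h'

theorem not_sameCycle_mul_apply (hm : Function.Involutive m) (hp : Function.Involutive p)
    (hm0 : ∀ x, m x ≠ x) (hp0 : ∀ x, p x ≠ x) (x : α) : ¬ SameCycle (m * p) x (p x) := by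
  rintro ⟨k, hk⟩
  have key : ∀ j : ℤ, p (((m * p) ^ j) x) = ((m * p) ^ (k - j)) x := fun j => by
    rw [apply_mul_zpow_apply hm hp, ← hk, ← Perm.mul_apply, ← zpow_add, neg_add_eq_sub]
  obtain ⟨j, rfl | rfl⟩ := k.even_or_odd'
  · exact hp0 _ ((key j).trans (by rw [two_mul, add_sub_cancel_right]))
  · refine hm0 (p (((m * p) ^ j) x)) ?_
    conv_rhs => rw [key, show 2 * j + 1 - j = 1 + j by ring, zpow_add, zpow_one]
    rfl

theorem sameCycle_mul_apply_right (hm : Function.Involutive m) (hp : Function.Involutive p)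
    {x y : α} (h : SameCycle (m * p) x y) : SameCycle (m * p) (p x) (p y) := by
  obtain ⟨k, rfl⟩ := h
  exact ⟨-k, (apply_mul_zpow_apply hm hp k x).symm⟩

theorem card_filter_invariant [Fintype α] [DecidableEq α] (hm : Function.Involutive m)
    (hp : Function.Involutive p) (hm0 : ∀ x, m x ≠ x) (hp0 : ∀ x, p x ≠ x) (d : ℕ) :
    (Finset.univ.filter fun f : α → Fin d => f ∘ m = f ∧ f ∘ p = f).card =
      d ^ (Nat.card (Quotient (SameCycle.setoid (m * p))) / 2) := by
  classical
  let τ : Quotient (SameCycle.setoid (m * p)) → Quotient (SameCycle.setoid (m * p)) :=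
    Quotient.map p fun _ _ h => sameCycle_mul_apply_right hm hp h
  have hτ : Function.Involutive τ := fun q => by
    induction q using Quotient.inductionOn with
    | h x => exact congrArg (Quotient.mk _) (hp x)
  have hτ0 : ∀ q, τ q ≠ q := fun q => by
    induction q using Quotient.inductionOn with
    | h x => exact fun h => not_sameCycle_mul_apply hm hp hm0 hp0 x (Quotient.exact h.symm)
  have := Fintype.ofFinite (Quotient (involutionSetoid τ hτ))
  let π : α → Quotient (involutionSetoid τ hτ) := fun x => Quotient.mk _ (Quotient.mk _ x)
  have hπ : Function.Surjective π := Quotient.mk_surjective.comp Quotient.mk_surjective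
  have hπp : π ∘ p = π := funext fun x =>
    (Quotient.sound (s := involutionSetoid τ hτ) (a := Quotient.mk _ x) (Or.inr rfl)).symm
  have hπm : π ∘ m = π := funext fun x => by
    have h : SameCycle (m * p) (p x) (m x) := ⟨1, by simp [hp x]⟩
    exact (congrArg (Quotient.mk _) (Quotient.sound h.symm)).trans (congrFun hπp x)
  have himg : (Finset.univ.filter fun f : α → Fin d => f ∘ m = f ∧ f ∘ p = f) =
      Finset.univ.image fun g : Quotient (involutionSetoid τ hτ) → Fin d => g ∘ π := by
    ext f
    simp only [Finset.mem_filter, Finset.mem_univ, true_and, Finset.mem_image]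
    constructor
    · rintro ⟨hfm, hfp⟩
      have hσ : ∀ (k : ℤ) x, f (((m * p) ^ k) x) = f x := fun k => by
        induction k with
        | zero => simp
        | succ k ih =>
          intro x
          rw [zpow_add, zpow_one, Perm.mul_apply, ih]
          exact (congrFun hfm (p x)).trans (congrFun hfp x)
        | pred k ih =>
          intro x
          rw [← ih x, show (-k : ℤ) = 1 + (-k - 1) by ring, zpow_add, zpow_one, Perm.mul_apply,
            add_sub_cancel_left]
          exact ((congrFun hfm (p _)).trans (congrFun hfp _)).symm
      refine ⟨Quotient.lift (Quotient.lift f ?_) ?_, rfl⟩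
      · rintro x y ⟨k, rfl⟩
        exact (hσ k x).symm
      · intro q q' h
        induction q using Quotient.inductionOn with
        | h x =>
          rcases h with rfl | rfl
          · rfl
          · exact (congrFun hfp x).symm
    · rintro ⟨g, rfl⟩
      exact ⟨by rw [Function.comp_assoc, hπm], by rw [Function.comp_assoc, hπp]⟩
  rw [himg, Finset.card_image_of_injective _ hπ.injective_comp_right, Finset.card_univ,
    Fintype.card_fun, Fintype.card_fin, card_eq_two_mul_card_quotient_involutionSetoid τ hτ hτ0,
    Nat.mul_div_cancel_left _ two_pos, Nat.card_eq_fintype_card]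

end Involutions

/-- The `0/1` matrix recording which colourings `f : Fin N → Fin d` are constant on the pairs
of a matching. -/
def colouringMatrix (d N : ℕ) : Matrix (Fin N → Fin d) (Matchings N) ℝ :=
  fun f m => if f ∘ m.1 = f then 1 else 0

theorem transpose_mul_colouringMatrix (d n : ℕ) :
    (colouringMatrix d (2 * n)).transpose * colouringMatrix d (2 * n) = GramO d n := by
  ext m p
  have h := card_filter_invariant (m := m.1) (p := p.1) m.2.1 p.2.1 m.2.2 p.2.2 d
  rw [← cycleCount_eq_card_quotient] at h
  simp only [Matrix.mul_apply, Matrix.transpose_apply, colouringMatrix, GramO, loopCount,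
    ← ite_and, mul_ite, mul_one, mul_zero]
  rw [Finset.sum_boole]
  exact_mod_cast (by simpa only [and_comm] using h)

/-- With at least `n` colours, some colouring takes distinct values on distinct pairs. -/
theorem exists_colouring {d n : ℕ} (hdn : n ≤ d) (m : Matchings (2 * n)) :
    ∃ f : Fin (2 * n) → Fin d, ∀ p : Matchings (2 * n), f ∘ p.1 = f ↔ p = m := by
  have hcard := card_eq_two_mul_card_quotient_involutionSetoid m.1 m.2.1 m.2.2
  have := Fintype.ofFinite (Quotient (involutionSetoid m.1 m.2.1))
  rw [Nat.card_eq_fintype_card, Nat.card_eq_fintype_card, Fintype.card_fin] at hcard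
  obtain ⟨e⟩ : Nonempty (Quotient (involutionSetoid m.1 m.2.1) ↪ Fin d) :=
    Function.Embedding.nonempty_of_card_le (by rw [Fintype.card_fin]; omega)
  refine ⟨fun x => e (Quotient.mk _ x), fun p => ⟨fun h => ?_, ?_⟩⟩
  · refine Subtype.ext (Equiv.ext fun x => ?_)
    have hx : involutionSetoid m.1 m.2.1 x (p.1 x) :=
      Quotient.exact (e.injective (congrFun h x).symm)
    exact hx.resolve_left (p.2.2 x)
  · rintro rfl
    exact funext fun x => congrArg e
      (Quotient.sound (s := involutionSetoid p.1 p.2.1) (a := x) (Or.inr rfl)).symm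

theorem colouringMatrix_mulVec_eq_zero {d n : ℕ} (hdn : n ≤ d) {v : Matchings (2 * n) → ℝ}
    (hv : (colouringMatrix d (2 * n)).mulVec v = 0) : v = 0 := by
  funext m
  obtain ⟨f, hf⟩ := exists_colouring hdn m
  simpa [Matrix.mulVec, dotProduct, colouringMatrix, hf] using congrFun hv f

theorem stmt6 (d n : ℕ) (hd : 0 < d) (hn : 0 < n) (hdn : d ≥ n) :
    IsUnit (GramO d n) := by
  rw [← Matrix.mulVec_injective_iff_isUnit, ← Matrix.coe_mulVecLin, ← LinearMap.ker_eq_bot,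
    ← transpose_mul_colouringMatrix, Matrix.ker_mulVecLin_transpose_mul_self, LinearMap.ker_eq_bot']
  exact fun v hv => colouringMatrix_mulVec_eq_zero hdn hv
end

section
/- Let d and n be positive integers and let U(d) carry its Haar probability measure. Let W be a symmetric real matrix indexed by the symmetric group S_n satisfying G·W·G = G, where G = G_n^{U(d)} is the unitary Gram matrix with entries G(σ,τ) = d^{c(σ⁻¹τ)}. Then for any index functions i, j, i′, j′ : Fin n → Fin d, ∫_{U(d)} ∏_{k=1}^{n} g_{i(k) j(k)} · ∏_{k=1}^{n} conj(g_{i′(k) j′(k)}) dg = ∑_{σ,τ ∈ S_n} W(σ,τ) · [∀k, i(k) = i′(σ(k))] · [∀k, j(k) = j′(τ(k))], where [P] is 1 if P holds and 0 otherwise. -/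
open MeasureTheory

/-- The unitary Gram matrix `G_n^{U(d)}`. -/
noncomputable def GramU (d n : ℕ) :
    Matrix (Equiv.Perm (Fin n)) (Equiv.Perm (Fin n)) ℝ :=
  fun σ τ => (d : ℝ) ^ cycleCount (σ⁻¹ * τ)

/-- The unitary group `U(d)`. -/
abbrev UnitGroup (d : ℕ) : Type := Matrix.unitaryGroup (Fin d) ℂ

noncomputable instance (d : ℕ) : MeasurableSpace (UnitGroup d) := borel _

section Combinatorics

variable {n : ℕ}

/-- The label of the orbit of `x`: a fixed point or a nontrivial cycle factor. -/
def orbitLabel (ρ : Equiv.Perm (Fin n)) (x : Fin n) :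
    ρ.cycleFactorsFinset ⊕ {x : Fin n // ρ x = x} :=
  if h : ρ x = x then Sum.inr ⟨x, h⟩
  else Sum.inl ⟨ρ.cycleOf x, Equiv.Perm.cycleOf_mem_cycleFactorsFinset_iff.2
    (Equiv.Perm.mem_support.2 h)⟩

lemma orbitLabel_surjective (ρ : Equiv.Perm (Fin n)) : Function.Surjective (orbitLabel ρ) := by
  rintro (⟨c, hc⟩ | ⟨x, hx⟩)
  · obtain ⟨x, hx⟩ := (Equiv.Perm.mem_cycleFactorsFinset_iff.1 hc).1.nonempty_support
    have hxc := Equiv.Perm.cycle_is_cycleOf hx hc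
    have hxρ : ρ x ≠ x :=
      Equiv.Perm.mem_support.1 (Equiv.Perm.mem_cycleFactorsFinset_support_le hc hx)
    exact ⟨x, by simp [orbitLabel, hxρ, hxc]⟩
  · exact ⟨x, by simp [orbitLabel, hx]⟩

lemma orbitLabel_apply_self (ρ : Equiv.Perm (Fin n)) (x : Fin n) :
    orbitLabel ρ (ρ x) = orbitLabel ρ x := by
  by_cases h : ρ x = x
  · rw [h]
  · simp [orbitLabel, h]

lemma sameCycle_of_orbitLabel_eq {ρ : Equiv.Perm (Fin n)} {x y : Fin n}
    (h : orbitLabel ρ x = orbitLabel ρ y) : ρ.SameCycle x y := by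
  by_cases hx : ρ x = x <;> by_cases hy : ρ y = y
  · simp only [orbitLabel, hx, hy, dite_true, Sum.inr.injEq, Subtype.mk.injEq] at h
    rw [h]
  · simp [orbitLabel, hx, hy] at h
  · simp [orbitLabel, hx, hy] at h
  · simp only [orbitLabel, hx, hy, dite_false, Sum.inl.injEq, Subtype.mk.injEq] at h
    have hm : y ∈ (ρ.cycleOf x).support := by
      rw [h]; exact Equiv.Perm.mem_support_cycleOf_iff.2 ⟨.refl _ _, Equiv.Perm.mem_support.2 hy⟩
    exact (Equiv.Perm.mem_support_cycleOf_iff.1 hm).1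

lemma card_orbitLabel (ρ : Equiv.Perm (Fin n)) :
    Fintype.card (ρ.cycleFactorsFinset ⊕ {x : Fin n // ρ x = x}) = cycleCount ρ := by
  simp [cycleCount, Equiv.Perm.cycleType_def, Fintype.card_subtype]

lemma eq_of_sameCycle {α : Type*} {ρ : Equiv.Perm (Fin n)} {a : Fin n → α}
    (ha : ∀ k, a (ρ k) = a k) {x y : Fin n} (h : ρ.SameCycle x y) : a x = a y := by
  obtain ⟨m, rfl⟩ := h.exists_nat_pow_eq
  induction m with
  | zero => simp
  | succ m ih =>
    have := ih ⟨m, by simp⟩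
    rw [pow_succ', Equiv.Perm.mul_apply, ha, ← this]

/-- A function invariant under a permutation amounts to a free value on each orbit. -/
lemma card_invariant_functions (d : ℕ) (ρ : Equiv.Perm (Fin n)) :
    (Finset.univ.filter fun a : Fin n → Fin d => ∀ k, a (ρ k) = a k).card
      = d ^ cycleCount ρ := by
  have himg : (Finset.univ.filter fun a : Fin n → Fin d => ∀ k, a (ρ k) = a k) =
      Finset.univ.image (fun f : (ρ.cycleFactorsFinset ⊕ {x : Fin n // ρ x = x}) → Fin d =>
        f ∘ orbitLabel ρ) := by
    ext a
    simp only [Finset.mem_filter, Finset.mem_univ, true_and, Finset.mem_image]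
    constructor
    · intro ha
      refine ⟨fun q => a (orbitLabel_surjective ρ q).choose, funext fun x => ?_⟩
      exact eq_of_sameCycle ha
        (sameCycle_of_orbitLabel_eq (orbitLabel_surjective ρ (orbitLabel ρ x)).choose_spec)
    · rintro ⟨f, rfl⟩ k
      simp [orbitLabel_apply_self]
  rw [himg, Finset.card_image_of_injective _ (orbitLabel_surjective ρ).injective_comp_right,
    Finset.card_univ, Fintype.card_fun, card_orbitLabel, Fintype.card_fin]

/-- The Gram matrix is the matrix of inner products of the permutation tensors. -/
lemma sum_indicator_mul_indicator (d : ℕ) (R : Type*) [CommRing R] (σ τ : Equiv.Perm (Fin n)) :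
    ∑ a : Fin n → Fin d, ∑ b : Fin n → Fin d,
      (if ∀ k, a k = b (σ k) then (1 : R) else 0) * (if ∀ k, a k = b (τ k) then 1 else 0)
      = (d : R) ^ cycleCount (σ⁻¹ * τ) := by
  rw [Finset.sum_comm, ← Nat.cast_pow, ← card_invariant_functions, Finset.card_filter,
    Nat.cast_sum]
  refine Fintype.sum_equiv (Equiv.arrowCongr σ.symm (Equiv.refl _)) _ _ fun b => ?_
  have h (a : Fin n → Fin d) : (∀ k, a k = b (σ k)) ↔ a = b ∘ σ := by
    simp [funext_iff]
  simp only [h, ite_mul, one_mul, zero_mul, Finset.sum_ite_eq', Finset.mem_univ,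
    if_true]
  simp [eq_comm]

/-- A vector in the kernel of the Gram matrix is a linear relation between the permutation
tensors. -/
lemma sum_mul_indicator_eq_zero {d : ℕ} {v : Equiv.Perm (Fin n) → ℝ}
    (hv : (GramU d n).mulVec v = 0) (a b : Fin n → Fin d) :
    ∑ σ, v σ * (if ∀ k, a k = b (σ k) then (1 : ℝ) else 0) = 0 := by
  have hsum : ∑ a : Fin n → Fin d, ∑ b : Fin n → Fin d,
      (∑ σ : Equiv.Perm (Fin n), v σ * (if ∀ k, a k = b (σ k) then (1 : ℝ) else 0)) ^ 2 = 0 := by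
    have : v ⬝ᵥ (GramU d n).mulVec v = 0 := by simp [hv]
    refine Eq.trans ?_ this
    simp only [dotProduct, Matrix.mulVec, GramU, ← sum_indicator_mul_indicator, sq,
      Finset.mul_sum, Finset.sum_mul]
    calc _ = ∑ a : Fin n → Fin d, ∑ σ : Equiv.Perm (Fin n), ∑ τ : Equiv.Perm (Fin n),
            ∑ b : Fin n → Fin d,
            v τ * (if ∀ k, a k = b (τ k) then (1 : ℝ) else 0) *
              (v σ * (if ∀ k, a k = b (σ k) then (1 : ℝ) else 0)) := by
          refine Finset.sum_congr rfl fun a _ => ?_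
          rw [Finset.sum_comm]
          exact Finset.sum_congr rfl fun σ _ => Finset.sum_comm
      _ = _ := by
          rw [Finset.sum_comm]
          refine Finset.sum_congr rfl fun σ _ => ?_
          rw [Finset.sum_comm]
          refine Finset.sum_congr rfl fun τ _ => Finset.sum_congr rfl fun a _ =>
            Finset.sum_congr rfl fun b _ => by ring
  have h1 := (Finset.sum_eq_zero_iff_of_nonneg
    (fun a _ => Finset.sum_nonneg fun b _ => sq_nonneg _)).1 hsum a (Finset.mem_univ a)
  have h2 := (Finset.sum_eq_zero_iff_of_nonneg (fun b _ => sq_nonneg _)).1 h1 b (Finset.mem_univ b)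
  exact pow_eq_zero_iff two_ne_zero |>.1 h2

end Combinatorics

section SchurWeyl

open Matrix

variable {n d : ℕ}

/-- The matrix of the tensor product of the operators `X k` on the `n`-th tensor power of `ℂ ^ d`. -/
def tensorMatrix (X : Fin n → Matrix (Fin d) (Fin d) ℂ) :
    Matrix (Fin n → Fin d) (Fin n → Fin d) ℂ :=
  fun a b => ∏ k, X k (a k) (b k)

/-- The matrix permuting the factors of the `n`-th tensor power of `ℂ ^ d`. -/
def permTensor (d : ℕ) (σ : Equiv.Perm (Fin n)) : Matrix (Fin n → Fin d) (Fin n → Fin d) ℂ :=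
  fun a b => if ∀ k, a k = b (σ k) then 1 else 0

lemma tensorMatrix_mul (X Y : Fin n → Matrix (Fin d) (Fin d) ℂ) :
    tensorMatrix X * tensorMatrix Y = tensorMatrix (fun k => X k * Y k) := by
  ext a b
  simp only [tensorMatrix, Matrix.mul_apply, ← Finset.prod_mul_distrib, Finset.prod_univ_sum,
    Fintype.piFinset_univ]

lemma tensorMatrix_one : tensorMatrix (fun _ : Fin n => (1 : Matrix (Fin d) (Fin d) ℂ)) = 1 := by
  ext a b
  simp only [tensorMatrix, Matrix.one_apply, Finset.prod_ite_zero, funext_iff]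
  simp

lemma tensorMatrix_conjTranspose (X : Fin n → Matrix (Fin d) (Fin d) ℂ) :
    (tensorMatrix X)ᴴ = tensorMatrix (fun k => (X k)ᴴ) := by
  ext a b
  simp [tensorMatrix, Matrix.conjTranspose_apply]

lemma permTensor_mul_apply (σ : Equiv.Perm (Fin n))
    (X : Matrix (Fin n → Fin d) (Fin n → Fin d) ℂ) (a b : Fin n → Fin d) :
    (permTensor d σ * X) a b = X (a ∘ σ.symm) b := by
  have h (c : Fin n → Fin d) : (∀ k, a k = c (σ k)) ↔ c = a ∘ σ.symm := by
    rw [eq_comm, ← Equiv.eq_comp_symm (f := a)]; simp [funext_iff]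
  simp [Matrix.mul_apply, permTensor, h]

lemma mul_permTensor_apply (σ : Equiv.Perm (Fin n))
    (X : Matrix (Fin n → Fin d) (Fin n → Fin d) ℂ) (a b : Fin n → Fin d) :
    (X * permTensor d σ) a b = X a (b ∘ σ) := by
  have h (c : Fin n → Fin d) : (∀ k, c k = b (σ k)) ↔ c = b ∘ σ := by
    simp [funext_iff]
  simp [Matrix.mul_apply, permTensor, h]

lemma permTensor_mul (σ τ : Equiv.Perm (Fin n)) :
    permTensor d σ * permTensor d τ = permTensor d (τ * σ) := by
  ext a b
  rw [mul_permTensor_apply]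
  simp only [permTensor, Function.comp_apply, Equiv.Perm.mul_apply]
  congr

lemma permTensor_one : permTensor d (1 : Equiv.Perm (Fin n)) = 1 := by
  ext a b
  simp only [permTensor, Matrix.one_apply, funext_iff, Equiv.Perm.one_apply]
  congr

lemma permTensor_commute_tensorMatrix (σ : Equiv.Perm (Fin n))
    (M : Matrix (Fin d) (Fin d) ℂ) :
    Commute (permTensor d σ) (tensorMatrix fun _ => M) := by
  ext a b
  rw [permTensor_mul_apply, mul_permTensor_apply]
  refine Fintype.prod_equiv σ.symm _ _ fun k => by simp

/-- Polarization: the polynomial in the coefficients `t` obtained by evaluating a linear functional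
at the `n`-th tensor power of `∑ k, t k • X k`. -/
noncomputable def polarPoly {κ : Type*} [Fintype κ] [DecidableEq κ]
    (f : Matrix (Fin n → Fin d) (Fin n → Fin d) ℂ →ₗ[ℂ] ℂ)
    (X : κ → Matrix (Fin d) (Fin d) ℂ) : MvPolynomial κ ℂ :=
  ∑ φ : Fin n → κ, MvPolynomial.monomial (∑ l, Finsupp.single (φ l) 1)
    (f (tensorMatrix fun l => X (φ l)))

lemma eval_polarPoly {κ : Type*} [Fintype κ] [DecidableEq κ]
    (f : Matrix (Fin n → Fin d) (Fin n → Fin d) ℂ →ₗ[ℂ] ℂ)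
    (X : κ → Matrix (Fin d) (Fin d) ℂ) (t : κ → ℂ) :
    MvPolynomial.eval t (polarPoly f X) = f (tensorMatrix fun _ => ∑ k, t k • X k) := by
  have h : (tensorMatrix fun _ : Fin n => ∑ k, t k • X k) =
      ∑ φ : Fin n → κ, (∏ l, t (φ l)) • tensorMatrix fun l => X (φ l) := by
    ext a b
    simp only [tensorMatrix, Matrix.sum_apply, Matrix.smul_apply, smul_eq_mul,
      Finset.prod_univ_sum, Fintype.piFinset_univ, Finset.prod_mul_distrib]
  have hm (φ : Fin n → κ) (c : ℂ) :
      MvPolynomial.eval t (MvPolynomial.monomial (∑ l, Finsupp.single (φ l) 1) c)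
        = (∏ l, t (φ l)) * c := by
    rw [← mul_one c, ← MvPolynomial.C_mul_monomial, MvPolynomial.monomial_sum_one]
    simp [mul_comm, MvPolynomial.eval_monomial]
  simp [h, polarPoly, hm]

lemma polarPoly_eq_zero {κ : Type*} [Fintype κ] [DecidableEq κ]
    {f : Matrix (Fin n → Fin d) (Fin n → Fin d) ℂ →ₗ[ℂ] ℂ}
    {X : κ → Matrix (Fin d) (Fin d) ℂ} {s : Set ℂ} (hs : s.Infinite)
    (h : ∀ t : κ → ℂ, (∀ k, t k ∈ s) → f (tensorMatrix fun _ => ∑ k, t k • X k) = 0) :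
    polarPoly f X = 0 := by
  refine MvPolynomial.funext_set (fun _ => s) (fun _ => hs) fun t ht => ?_
  rw [eval_polarPoly, map_zero, h t fun k => ht k (Set.mem_univ k)]

/-- A functional killing the `n`-th tensor powers of all matrices kills the symmetrizations of all
pure tensors. -/
lemma map_sum_perm_tensorMatrix_eq_zero
    {f : Matrix (Fin n → Fin d) (Fin n → Fin d) ℂ →ₗ[ℂ] ℂ}
    (h : ∀ M : Matrix (Fin d) (Fin d) ℂ, f (tensorMatrix fun _ => M) = 0)
    (X : Fin n → Matrix (Fin d) (Fin d) ℂ) :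
    f (∑ σ : Equiv.Perm (Fin n), tensorMatrix fun l => X (σ l)) = 0 := by
  have h0 : polarPoly f X = 0 := polarPoly_eq_zero Set.infinite_univ fun t _ => h _
  have hc := congrArg (MvPolynomial.coeff (∑ l, Finsupp.single l 1)) h0
  have hb (φ : Fin n → Fin n) : (∑ l, Finsupp.single (φ l) 1 : Fin n →₀ ℕ)
      = ∑ l, Finsupp.single l 1 ↔ Function.Bijective φ := by
    refine ⟨fun hφ => Finite.surjective_iff_bijective.1 fun k => ?_, fun hφ => ?_⟩
    · by_contra hk
      push Not at hk
      have := DFunLike.congr_fun hφ k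
      simp [Finsupp.finsetSum_apply, Finsupp.single_apply, hk] at this
    · exact Fintype.sum_bijective φ hφ _ _ fun _ => rfl
  simp only [polarPoly, MvPolynomial.coeff_sum, MvPolynomial.coeff_monomial, hb,
    MvPolynomial.coeff_zero] at hc
  rw [map_sum, ← hc, ← Finset.sum_filter]
  symm
  refine Finset.sum_bij' (fun φ hφ => Equiv.ofBijective φ (by simpa using hφ))
    (fun σ _ => σ) (by simp) (fun σ _ => Finset.mem_filter.2 ⟨Finset.mem_univ _, σ.bijective⟩)
    (fun _ _ => rfl) (fun σ _ => Equiv.ext fun _ => rfl) (fun _ _ => rfl)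

/-- A functional killing the `n`-th tensor powers of Hermitian matrices kills those of all
matrices. -/
lemma map_tensorMatrix_eq_zero_of_isHermitian
    {f : Matrix (Fin n → Fin d) (Fin n → Fin d) ℂ →ₗ[ℂ] ℂ}
    (h : ∀ M : Matrix (Fin d) (Fin d) ℂ, M.IsHermitian → f (tensorMatrix fun _ => M) = 0)
    (M : Matrix (Fin d) (Fin d) ℂ) : f (tensorMatrix fun _ => M) = 0 := by
  let X : Fin 2 → Matrix (Fin d) (Fin d) ℂ := ![(realPart M : Matrix _ _ ℂ), imaginaryPart M]
  have hX (k : Fin 2) : (X k).IsHermitian := by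
    fin_cases k
    · exact (realPart M).2
    · exact (imaginaryPart M).2
  have h0 : polarPoly f X = 0 := by
    refine polarPoly_eq_zero (s := Set.range ((↑) : ℝ → ℂ))
      (Set.infinite_range_of_injective Complex.ofReal_injective) fun t ht => h _ ?_
    choose r hr using ht
    refine isSelfAdjoint_sum _ fun k _ => ?_
    rw [← hr k]
    exact IsSelfAdjoint.smul (by simp [isSelfAdjoint_iff]) (hX k)
  have := eval_polarPoly f X ![1, Complex.I]
  rw [h0, map_zero] at this
  rw [this]
  congr 2
  funext _
  simp [X, Fin.sum_univ_two, realPart_add_I_smul_imaginaryPart]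

/-- Commutation with the tensor powers of unitary matrices passes to those of diagonal matrices. -/
lemma commute_tensorMatrix_diagonal {A : Matrix (Fin n → Fin d) (Fin n → Fin d) ℂ}
    (hA : ∀ g ∈ unitaryGroup (Fin d) ℂ, Commute A (tensorMatrix fun _ => g)) (z : Fin d → ℂ) :
    Commute A (tensorMatrix fun _ => diagonal z) := by
  have hdiag (z : Fin d → ℂ) : (tensorMatrix fun _ : Fin n => diagonal z) =
      diagonal fun a => ∏ k, z (a k) := by
    ext a b
    simp only [tensorMatrix, diagonal_apply, Finset.prod_ite_zero, funext_iff]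
    simp
  ext a b
  rw [hdiag, mul_diagonal, diagonal_mul]
  have hp : MvPolynomial.C (A a b) * ∏ k, MvPolynomial.X (b k) =
      (∏ k, MvPolynomial.X (a k)) * MvPolynomial.C (A a b) := by
    refine MvPolynomial.funext_set (fun _ => Metric.sphere (0 : ℂ) 1) (fun _ => ?_) fun t ht => ?_
    · exact (isPreconnected_sphere (by simp [Complex.rank_real_complex]) 0 1).infinite_of_nontrivial
        ⟨1, by simp, -1, by simp, by norm_num⟩
    · have hU : diagonal t ∈ unitaryGroup (Fin d) ℂ := by
        rw [mem_unitaryGroup_iff, star_eq_conjTranspose, diagonal_conjTranspose, diagonal_mul_diagonal,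
          ← diagonal_one]
        congr 1
        funext k
        have := ht k (Set.mem_univ k)
        simp only [mem_sphere_zero_iff_norm] at this
        simp [Complex.mul_conj, Complex.normSq_eq_norm_sq, this]
      have := congrFun₂ (hA _ hU).eq a b
      rw [hdiag, mul_diagonal, diagonal_mul] at this
      simpa [map_prod] using this
  simpa [map_prod] using congrArg (MvPolynomial.eval z) hp

lemma commute_tensorMatrix_of_isHermitian {A : Matrix (Fin n → Fin d) (Fin n → Fin d) ℂ}
    (hA : ∀ g ∈ unitaryGroup (Fin d) ℂ, Commute A (tensorMatrix fun _ => g))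
    {M : Matrix (Fin d) (Fin d) ℂ} (hM : M.IsHermitian) :
    Commute A (tensorMatrix fun _ => M) := by
  rw [hM.spectral_theorem, Unitary.conjStarAlgAut_apply, ← tensorMatrix_mul, ← tensorMatrix_mul]
  exact ((hA _ hM.eigenvectorUnitary.2).mul_right (commute_tensorMatrix_diagonal hA _)).mul_right
    (hA _ (star hM.eigenvectorUnitary).2)

/-- A matrix commuting with the tensor powers of all unitary matrices commutes with every matrix
that commutes with the permutations of the tensor factors. -/
lemma commute_of_commute_permTensor {A B : Matrix (Fin n → Fin d) (Fin n → Fin d) ℂ}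
    (hA : ∀ g ∈ unitaryGroup (Fin d) ℂ, Commute A (tensorMatrix fun _ => g))
    (hB : ∀ σ, Commute (permTensor d σ) B) : Commute A B := by
  have hsym (X : Fin n → Matrix (Fin d) (Fin d) ℂ) :
      Commute A (∑ σ : Equiv.Perm (Fin n), tensorMatrix fun l => X (σ l)) := by
    ext a b
    let f : Matrix (Fin n → Fin d) (Fin n → Fin d) ℂ →ₗ[ℂ] ℂ :=
      entryLinearMap ℂ ℂ a b ∘ₗ (LinearMap.mulLeft ℂ A - LinearMap.mulRight ℂ A)
    have hf (M : Matrix (Fin n → Fin d) (Fin n → Fin d) ℂ) : f M = (A * M) a b - (M * A) a b := by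
      simp [f]
    have := map_sum_perm_tensorMatrix_eq_zero (f := f) (map_tensorMatrix_eq_zero_of_isHermitian
      fun M hM => by
        rw [hf, (commute_tensorMatrix_of_isHermitian hA hM).eq, sub_self]) X
    rwa [hf, sub_eq_zero] at this
  have hBperm (σ : Equiv.Perm (Fin n)) (a b : Fin n → Fin d) : B (a ∘ σ) (b ∘ σ) = B a b := by
    have := congrFun₂ (hB σ).eq (a ∘ σ) b
    rw [permTensor_mul_apply, mul_permTensor_apply] at this
    simpa [Function.comp_assoc] using this.symm
  have hBsum : (Fintype.card (Equiv.Perm (Fin n)) : ℂ) • B = ∑ a, ∑ b, B a b •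
      ∑ σ : Equiv.Perm (Fin n), tensorMatrix fun l => Matrix.single (a (σ l)) (b (σ l)) 1 := by
    have hs (a b : Fin n → Fin d) : (tensorMatrix fun l => Matrix.single (a l) (b l) 1) =
        Matrix.single a b 1 := by
      ext a' b'
      simp only [tensorMatrix, Matrix.single_apply, Finset.prod_ite_zero, funext_iff]
      simp [forall_and]
    calc _ = ∑ σ : Equiv.Perm (Fin n), ∑ a, ∑ b, B (a ∘ σ) (b ∘ σ) •
          tensorMatrix (fun l => Matrix.single ((a ∘ σ) l) ((b ∘ σ) l) 1) := by
          rw [Nat.cast_smul_eq_nsmul, ← Finset.card_univ, ← Finset.sum_const]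
          refine Finset.sum_congr rfl fun σ _ => ?_
          nth_rewrite 1 [Matrix.matrix_eq_sum_single B]
          refine (Fintype.sum_equiv (σ.arrowCongr (Equiv.refl _)) _ _ fun a => ?_)
          refine (Fintype.sum_equiv (σ.arrowCongr (Equiv.refl _)) _ _ fun b => ?_)
          have hσ (c : Fin n → Fin d) : (σ.arrowCongr (Equiv.refl (Fin d))) c ∘ σ = c := by
            ext; simp
          rw [hs, hσ, hσ]
          simp
      _ = _ := by
          simp only [hBperm, Finset.smul_sum, Function.comp_apply]
          rw [Finset.sum_comm]
          exact Finset.sum_congr rfl fun a _ => Finset.sum_comm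
  have hc : Commute A ((Fintype.card (Equiv.Perm (Fin n)) : ℂ) • B) := by
    rw [hBsum]
    exact Commute.sum_right _ _ _ fun a _ => Commute.sum_right _ _ _ fun b _ =>
      (hsym fun l => Matrix.single (a l) (b l) 1).smul_right _
  have hcard : (Fintype.card (Equiv.Perm (Fin n)) : ℂ) ≠ 0 := by simp [Fintype.card_ne_zero]
  simpa [smul_smul, hcard] using hc.smul_right (Fintype.card (Equiv.Perm (Fin n)) : ℂ)⁻¹

/-- The commutant of the tensor powers of unitary matrices is spanned by the permutations of the
tensor factors. -/
lemma mem_span_permTensor {A : Matrix (Fin n → Fin d) (Fin n → Fin d) ℂ}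
    (hA : ∀ g ∈ unitaryGroup (Fin d) ℂ, Commute A (tensorMatrix fun _ => g)) :
    A ∈ Submodule.span ℂ (Set.range (permTensor d : Equiv.Perm (Fin n) → _)) := by
  set S := Submodule.span ℂ (Set.range (permTensor d : Equiv.Perm (Fin n) → _)) with hS
  have hmulS (σ : Equiv.Perm (Fin n)) {X} (hX : X ∈ S) : permTensor d σ * X ∈ S := by
    have : S ≤ S.comap (LinearMap.mulLeft ℂ (permTensor d σ)) := by
      rw [hS, Submodule.span_le]
      rintro _ ⟨τ, rfl⟩
      simp only [Submodule.comap_coe, Set.mem_preimage, LinearMap.mulLeft_apply, permTensor_mul]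
      exact Submodule.subset_span ⟨_, rfl⟩
    exact this hX
  obtain ⟨q, hq⟩ := S.subtype.exists_leftInverse_of_injective (by simp)
  have hq' {X} (hX : X ∈ S) : (q X : Matrix (Fin n → Fin d) (Fin n → Fin d) ℂ) = X :=
    congrArg Subtype.val (LinearMap.congr_fun hq ⟨X, hX⟩)
  -- the projection onto `S`, averaged over the permutations
  let Q : Matrix (Fin n → Fin d) (Fin n → Fin d) ℂ →ₗ[ℂ] Matrix (Fin n → Fin d) (Fin n → Fin d) ℂ :=
    ∑ σ : Equiv.Perm (Fin n), LinearMap.mulLeft ℂ (permTensor d σ⁻¹) ∘ₗ S.subtype ∘ₗ q ∘ₗ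
      LinearMap.mulLeft ℂ (permTensor d σ)
  have hQ (X) : Q X = ∑ σ : Equiv.Perm (Fin n), permTensor d σ⁻¹ * (q (permTensor d σ * X) : Matrix _ _ ℂ) := by
    simp [Q]
  have hQmem (X) : Q X ∈ S := by
    rw [hQ]
    exact S.sum_mem fun σ _ => hmulS _ (q _).2
  have hQone : Q 1 = (Fintype.card (Equiv.Perm (Fin n)) : ℂ) • 1 := by
    have h1 (σ : Equiv.Perm (Fin n)) : permTensor d σ ∈ S := Submodule.subset_span ⟨σ, rfl⟩
    simp only [hQ, mul_one, hq' (h1 _), permTensor_mul, mul_inv_cancel, permTensor_one]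
    simp [Nat.cast_smul_eq_nsmul, Finset.card_univ]
  have hQcomm (τ : Equiv.Perm (Fin n)) (X) : Q (permTensor d τ * X) = permTensor d τ * Q X := by
    rw [hQ, hQ, Finset.mul_sum]
    refine Fintype.sum_equiv (Equiv.mulLeft τ) _ _ fun σ => ?_
    simp only [← mul_assoc, permTensor_mul, Equiv.coe_mulLeft, _root_.mul_inv_rev]
    simp
  let K (b b' : Fin n → Fin d) : Matrix (Fin n → Fin d) (Fin n → Fin d) ℂ :=
    Matrix.of fun a a' => Q (Matrix.single a' b 1) a b'
  have hK (X a b') : Q X a b' = ∑ b, (K b b' * X) a b := by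
    conv_lhs => rw [Matrix.matrix_eq_sum_single X]
    have hs (a' b : Fin n → Fin d) :
        Matrix.single a' b (X a' b) = X a' b • Matrix.single a' b (1 : ℂ) := by simp
    simp only [hs, map_sum, map_smul, Matrix.sum_apply, Matrix.smul_apply, Matrix.mul_apply, K,
      Matrix.of_apply, smul_eq_mul]
    rw [Finset.sum_comm]
    simp only [mul_comm]
  have hKcomm (b b' τ) : Commute (permTensor d τ) (K b b') := by
    ext a a'
    have hs : (Matrix.single (a' ∘ τ) b 1 : Matrix _ _ ℂ) =
        permTensor d τ * Matrix.single a' b 1 := by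
      ext x y
      rw [permTensor_mul_apply]
      simp [Matrix.single_apply, Equiv.eq_comp_symm]
    rw [mul_permTensor_apply, permTensor_mul_apply]
    simp only [K, Matrix.of_apply, hs, hQcomm, permTensor_mul_apply]
  have hQA : Q A = A * Q 1 := by
    ext a b'
    rw [hK A, Matrix.mul_apply]
    simp only [hK 1, mul_one, Finset.mul_sum]
    rw [Finset.sum_comm]
    refine Finset.sum_congr rfl fun b _ => ?_
    rw [← (commute_of_commute_permTensor hA (hKcomm b b')).eq, Matrix.mul_apply]
  have hcard : (Fintype.card (Equiv.Perm (Fin n)) : ℂ) ≠ 0 := by simp [Fintype.card_ne_zero]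
  have := hQmem A
  rw [hQA, hQone, mul_smul_comm, mul_one] at this
  exact (S.smul_mem_iff hcard).1 this

end SchurWeyl

section HaarIntegral

open Matrix

variable {n d : ℕ}

instance (d : ℕ) : BorelSpace (UnitGroup d) := ⟨rfl⟩

lemma continuous_prod_entries (i j i' j' : Fin n → Fin d) :
    Continuous fun g : UnitGroup d => (∏ k, (g : Matrix (Fin d) (Fin d) ℂ) (i k) (j k)) *
      ∏ k, (starRingEnd ℂ) ((g : Matrix (Fin d) (Fin d) ℂ) (i' k) (j' k)) := by
  have h (a b : Fin d) : Continuous fun g : UnitGroup d => (g : Matrix (Fin d) (Fin d) ℂ) a b :=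
    continuous_subtype_val.matrix_elem a b
  exact (continuous_finsetProd _ fun k _ => h _ _).mul
    (continuous_finsetProd _ fun k _ => Complex.continuous_conj.comp (h _ _))

lemma integrable_prod_entries (μ : Measure (UnitGroup d)) [IsFiniteMeasure μ]
    (i j i' j' : Fin n → Fin d) :
    Integrable (fun g : UnitGroup d => (∏ k, (g : Matrix (Fin d) (Fin d) ℂ) (i k) (j k)) *
      ∏ k, (starRingEnd ℂ) ((g : Matrix (Fin d) (Fin d) ℂ) (i' k) (j' k))) μ := by
  refine .of_bound (continuous_prod_entries i j i' j').aestronglyMeasurable 1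
    (.of_forall fun g => ?_)
  rw [norm_mul, norm_prod, norm_prod]
  refine mul_le_one₀ (Finset.prod_le_one (fun _ _ => norm_nonneg _) fun k _ =>
    entry_norm_bound_of_unitary g.2 _ _) (Finset.prod_nonneg fun _ _ => norm_nonneg _)
    (Finset.prod_le_one (fun _ _ => norm_nonneg _) fun k _ => ?_)
  rw [RCLike.norm_conj]
  exact entry_norm_bound_of_unitary g.2 _ _

/-- The Haar average of `g^{⊗n} E g^{⊗n}*`, where `E` is the matrix unit at `(j, j')`. -/
noncomputable def haarTwirl (μ : Measure (UnitGroup d)) (j j' : Fin n → Fin d) :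
    Matrix (Fin n → Fin d) (Fin n → Fin d) ℂ :=
  fun i i' => ∫ g, ((∏ k, ((g : Matrix (Fin d) (Fin d) ℂ) (i k) (j k))) *
    ∏ k, (starRingEnd ℂ) ((g : Matrix (Fin d) (Fin d) ℂ) (i' k) (j' k))) ∂μ

lemma tensorMatrix_mul_haarTwirl_mul (μ : Measure (UnitGroup d)) [IsFiniteMeasure μ]
    [μ.IsMulLeftInvariant] (j j' : Fin n → Fin d) (h : UnitGroup d) :
    (tensorMatrix fun _ => (h : Matrix (Fin d) (Fin d) ℂ)) * haarTwirl μ j j' *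
      (tensorMatrix fun _ => (h : Matrix (Fin d) (Fin d) ℂ))ᴴ = haarTwirl μ j j' := by
  ext i i'
  have hmul (g : UnitGroup d) (i j : Fin n → Fin d) :
      ∏ k, ((h * g : UnitGroup d) : Matrix (Fin d) (Fin d) ℂ) (i k) (j k) =
        ∑ a, (tensorMatrix fun _ => (h : Matrix (Fin d) (Fin d) ℂ)) i a *
          ∏ k, (g : Matrix (Fin d) (Fin d) ℂ) (a k) (j k) :=
    (congrFun₂ (tensorMatrix_mul (fun _ => (h : Matrix (Fin d) (Fin d) ℂ))
      fun _ => (g : Matrix (Fin d) (Fin d) ℂ)) i j).symm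
  have hint (a b : Fin n → Fin d) (x y : ℂ) : Integrable (fun g : UnitGroup d =>
      x * (∏ k, (g : Matrix (Fin d) (Fin d) ℂ) (a k) (j k)) *
        (y * (starRingEnd ℂ) (∏ k, (g : Matrix (Fin d) (Fin d) ℂ) (b k) (j' k)))) μ := by
    refine ((integrable_prod_entries μ a j b j').const_mul (x * y)).congr (.of_forall fun g => ?_)
    simp only [map_prod]
    ring
  conv_rhs => rw [haarTwirl, ← integral_mul_left_eq_self _ h]
  simp only [← map_prod, hmul, map_sum, map_mul, Finset.sum_mul_sum]
  rw [integral_finsetSum]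
  · rw [Matrix.mul_apply]
    simp only [Matrix.mul_apply, Finset.sum_mul]
    rw [Finset.sum_comm]
    refine Finset.sum_congr rfl fun a _ => ?_
    rw [integral_finsetSum]
    · refine Finset.sum_congr rfl fun b _ => ?_
      rw [haarTwirl, conjTranspose_apply, ← integral_const_mul, ← integral_mul_const]
      refine integral_congr_ae (.of_forall fun g => ?_)
      simp only [map_prod, starRingEnd_apply]
      ring
    · exact fun b _ => hint a b _ _
  · exact fun a _ => integrable_finsetSum _ fun b _ => hint a b _ _

lemma commute_haarTwirl (μ : Measure (UnitGroup d)) [IsFiniteMeasure μ]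
    [μ.IsMulLeftInvariant] (j j' : Fin n → Fin d) {h : Matrix (Fin d) (Fin d) ℂ}
    (hh : h ∈ unitaryGroup (Fin d) ℂ) :
    Commute (haarTwirl μ j j') (tensorMatrix fun _ => h) := by
  have := tensorMatrix_mul_haarTwirl_mul μ j j' ⟨h, hh⟩
  have hstar : (tensorMatrix fun _ : Fin n => h)ᴴ * (tensorMatrix fun _ => h) = 1 := by
    rw [tensorMatrix_conjTranspose, tensorMatrix_mul, ← tensorMatrix_one]
    simp only [← star_eq_conjTranspose, mem_unitaryGroup_iff'.1 hh]
  rw [Commute, SemiconjBy]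
  nth_rewrite 1 [← this]
  rw [mul_assoc, hstar, mul_one]

/-- The Haar twirl has the same pairings with the permutation tensors as the matrix unit. -/
lemma sum_permTensor_mul_haarTwirl (μ : Measure (UnitGroup d)) [IsProbabilityMeasure μ]
    (j j' : Fin n → Fin d) (τ : Equiv.Perm (Fin n)) :
    ∑ i, ∑ i', permTensor d τ i i' * haarTwirl μ j j' i i' = permTensor d τ j j' := by
  have hpt (g : UnitGroup d) : ∑ i, ∑ i', permTensor d τ i i' *
      ((∏ k, (g : Matrix (Fin d) (Fin d) ℂ) (i k) (j k)) *
        ∏ k, (starRingEnd ℂ) ((g : Matrix (Fin d) (Fin d) ℂ) (i' k) (j' k))) =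
      permTensor d τ j j' := by
    set M := tensorMatrix fun _ : Fin n => (g : Matrix (Fin d) (Fin d) ℂ) with hM
    have hstar : Mᴴ * M = 1 := by
      rw [hM, tensorMatrix_conjTranspose, tensorMatrix_mul, ← tensorMatrix_one]
      simp only [← star_eq_conjTranspose, mem_unitaryGroup_iff'.1 g.2]
    have h1 : Mᴴ * (permTensor d τ * M) = permTensor d τ := by
      rw [(permTensor_commute_tensorMatrix τ _).eq, ← mul_assoc, hstar, one_mul]
    have hreal (i i') : star (permTensor d τ i i') = permTensor d τ i i' := by
      simp only [permTensor]; split_ifs <;> simp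
    have h2 := congrArg star (congrFun₂ h1 j j')
    rw [hreal] at h2
    rw [← h2]
    simp only [Matrix.mul_apply, star_sum, star_mul', Finset.mul_sum, conjTranspose_apply,
      star_star, hreal, hM, tensorMatrix, star_prod, starRingEnd_apply]
    exact Finset.sum_congr rfl fun i _ => Finset.sum_congr rfl fun i' _ => by ring
  have hint (i i') := (integrable_prod_entries μ i j i' j').const_mul (permTensor d τ i i')
  calc _ = ∫ g : UnitGroup d, ∑ i, ∑ i', permTensor d τ i i' *
      ((∏ k, (g : Matrix (Fin d) (Fin d) ℂ) (i k) (j k)) *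
        ∏ k, (starRingEnd ℂ) ((g : Matrix (Fin d) (Fin d) ℂ) (i' k) (j' k))) ∂μ := by
        rw [integral_finsetSum _ fun i _ => integrable_finsetSum _ fun i' _ => hint i i']
        refine Finset.sum_congr rfl fun i _ => ?_
        rw [integral_finsetSum _ fun i' _ => hint i i']
        exact Finset.sum_congr rfl fun i' _ => (integral_const_mul _ _).symm
    _ = _ := by simp only [hpt, integral_const, probReal_univ, one_smul]

end HaarIntegral

theorem stmt9 (d n : ℕ) (hd : 0 < d) (hn : 0 < n)
    (μ : Measure (UnitGroup d)) [μ.IsHaarMeasure] [IsProbabilityMeasure μ]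
    (W : Matrix (Equiv.Perm (Fin n)) (Equiv.Perm (Fin n)) ℝ)
    (hWsymm : W.IsSymm)
    (hW : GramU d n * W * GramU d n = GramU d n)
    (i j i' j' : Fin n → Fin d) :
    (∫ g, ((∏ k, ((g : Matrix (Fin d) (Fin d) ℂ) (i k) (j k))) *
        ∏ k, (starRingEnd ℂ) ((g : Matrix (Fin d) (Fin d) ℂ) (i' k) (j' k))) ∂μ) =
      ∑ σ : Equiv.Perm (Fin n), ∑ τ : Equiv.Perm (Fin n),
        (W σ τ : ℂ) * (if ∀ k, i k = i' (σ k) then (1:ℂ) else 0) *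
          (if ∀ k, j k = j' (τ k) then (1:ℂ) else 0) := by
  obtain ⟨c, hc⟩ := (Submodule.mem_span_range_iff_exists_fun ℂ).1
    (mem_span_permTensor fun g hg => commute_haarTwirl μ j j' hg)
  have hcapp (a b : Fin n → Fin d) :
      haarTwirl μ j j' a b = ∑ κ, c κ * permTensor d κ a b := by
    rw [← hc, Matrix.sum_apply]
    rfl
  have hgram (τ : Equiv.Perm (Fin n)) :
      ∑ κ, (GramU d n τ κ : ℂ) * c κ = permTensor d τ j j' := by
    have hG (κ : Equiv.Perm (Fin n)) :
        (GramU d n τ κ : ℂ) = ∑ a, ∑ b, permTensor d τ a b * permTensor d κ a b := by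
      simp only [permTensor]
      rw [sum_indicator_mul_indicator]
      simp [GramU]
    rw [← sum_permTensor_mul_haarTwirl μ]
    simp only [hcapp, Finset.mul_sum, hG, Finset.sum_mul]
    rw [Finset.sum_comm]
    refine Finset.sum_congr rfl fun a _ => ?_
    rw [Finset.sum_comm]
    refine Finset.sum_congr rfl fun b _ => Finset.sum_congr rfl fun κ _ => by ring
  have hrel (κ : Equiv.Perm (Fin n)) :
      ∑ σ, ((W * GramU d n) σ κ : ℂ) * permTensor d σ i i' = permTensor d κ i i' := by
    have hker : (GramU d n).mulVec (fun σ => (W * GramU d n) σ κ - (1 : Matrix _ _ ℝ) σ κ) = 0 := by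
      have : GramU d n * (W * GramU d n - 1) = 0 := by
        rw [mul_sub, ← mul_assoc, hW, mul_one, sub_self]
      exact funext fun τ => congrFun₂ this τ κ
    have h := congrArg ((↑) : ℝ → ℂ) (sum_mul_indicator_eq_zero hker i i')
    simp only [sub_mul, Finset.sum_sub_distrib, Matrix.one_apply, ite_mul, one_mul, zero_mul,
      Finset.sum_ite_eq', Finset.mem_univ, if_true, Complex.ofReal_sub, Complex.ofReal_sum,
      Complex.ofReal_mul, Complex.ofReal_zero, sub_eq_zero, apply_ite ((↑) : ℝ → ℂ),
      Complex.ofReal_one] at h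
    exact h
  change haarTwirl μ j j' i i' = ∑ σ, ∑ τ, (W σ τ : ℂ) * permTensor d σ i i' * permTensor d τ j j'
  simp only [← hgram]
  rw [hcapp, Finset.sum_congr rfl fun κ _ => congrArg (c κ * ·) (hrel κ).symm]
  simp only [Matrix.mul_apply, Complex.ofReal_sum, Complex.ofReal_mul, Finset.mul_sum,
    Finset.sum_mul]
  rw [Finset.sum_comm]
  refine Finset.sum_congr rfl fun σ _ => ?_
  rw [Finset.sum_comm]
  exact Finset.sum_congr rfl fun τ _ => Finset.sum_congr rfl fun κ _ => by ring
end
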